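/- Let (R,M) be a two-dimensional regular local ring with algebraically closed residue field. Let I be a simple complete M-primary ideal of R and let w denote its unique Rees valuation. Then the degree function coefficient d(I,w) = 1. -/

import Mathlib

open IsLocalRing

def Ideal.IsIntegralElemOver {R : Type*} [CommRing R] (I : Ideal R) (x : R) : Prop :=
  ∃ n : ℕ, 0 < n ∧ ∃ c : ℕ → R, (∀ i ∈ Finset.Icc 1 n, c i ∈ I ^ i) ∧
    x ^ n + ∑ i ∈ Finset.Icc 1 n, c i * x ^ (n - i) = 0

def Ideal.IsComplete {R : Type*} [CommRing R] (I : Ideal R) : Prop :=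
  ∀ x : R, I.IsIntegralElemOver x → x ∈ I

def Ideal.IsSimpleIdeal {R : Type*} [CommRing R] (I : Ideal R) : Prop :=
  I ≠ ⊤ ∧ ∀ J K : Ideal R, I = J * K → J = ⊤ ∨ K = ⊤

def Ideal.IsMPrimary {R : Type*} [CommRing R] [IsLocalRing R] (I : Ideal R) : Prop :=
  I.radical = maximalIdeal R

structure DiscreteValuationOn (R : Type*) [CommRing R] where
  v : R → ℕ∞
  v_zero : v 0 = ⊤
  v_one : v 1 = 0
  v_mul : ∀ x y, v (x * y) = v x + v y
  v_add : ∀ x y, min (v x) (v y) ≤ v (x + y)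
  v_top_iff : ∀ x, v x = ⊤ ↔ x = 0
  v_nontrivial : ∃ x, v x ≠ 0 ∧ v x ≠ ⊤

noncomputable def valIdeal {R : Type*} [CommRing R] (w : DiscreteValuationOn R) (I : Ideal R) : ℕ∞ :=
  ⨅ x ∈ I, w.v x

def IsReesValuationsOf {R : Type*} [CommRing R] (I : Ideal R)
    (T : Set (DiscreteValuationOn R)) : Prop :=
  T.Finite ∧
  (∀ (m : ℕ) (x : R), (I ^ m).IsIntegralElemOver x ↔
      ∀ w ∈ T, (m : ℕ∞) * valIdeal w I ≤ w.v x) ∧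
  ∀ T' ⊂ T, ¬ (∀ (m : ℕ) (x : R), (I ^ m).IsIntegralElemOver x ↔
      ∀ w ∈ T', (m : ℕ∞) * valIdeal w I ≤ w.v x)

noncomputable def moduleLength (R M : Type*) [CommRing R] [AddCommGroup M] [Module R M] : ℕ∞ :=
  ⨆ (n : ℕ) (_ : ∃ c : Fin (n + 1) → Submodule R M, StrictMono c), (n : ℕ∞)

noncomputable def hsLength {R : Type*} [CommRing R] (J : Ideal R) (n : ℕ) : ℕ∞ :=
  moduleLength R (R ⧸ J ^ n)

def HasMultiplicity₁ {R : Type*} [CommRing R] (J : Ideal R) (e : ℕ∞) : Prop :=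
  ∃ a b : ℕ, ∀ᶠ n : ℕ in Filter.atTop, hsLength J n + a = e * n + b

def HasMultiplicity₂ {R : Type*} [CommRing R] (J : Ideal R) (e : ℕ) : Prop :=
  ∃ a b a' b' : ℕ, ∀ᶠ n : ℕ in Filter.atTop,
    2 * hsLength J n + a * n + b = (e : ℕ∞) * n ^ 2 + a' * n + b'

def IsDegreeCoeffOfUnique {R : Type*} [CommRing R] [IsLocalRing R] (I : Ideal R)
    (w : DiscreteValuationOn R) (d : ℕ) : Prop :=
  ∀ x ∈ maximalIdeal R, x ≠ 0 →
    HasMultiplicity₁ (Ideal.map (Ideal.Quotient.mk (Ideal.span {x})) I) ((d : ℕ∞) * w.v x)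

namespace DegOne

section val
variable {R : Type*} [CommRing R]

lemma isDomain_of_val (w : DiscreteValuationOn R) : IsDomain R := by
  haveI : Nontrivial R := by
    refine ⟨0, 1, fun h => ?_⟩
    have h0 := w.v_zero
    rw [h, w.v_one] at h0
    exact absurd h0 (by simp)
  haveI : NoZeroDivisors R := by
    refine ⟨fun {a b} h => ?_⟩
    have h1 := w.v_mul a b
    rw [h, w.v_zero] at h1
    rcases WithTop.add_eq_top.mp h1.symm with h2 | h2
    · exact Or.inl ((w.v_top_iff a).mp h2)
    · exact Or.inr ((w.v_top_iff b).mp h2)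
  exact NoZeroDivisors.to_isDomain R

variable (w : DiscreteValuationOn R)

lemma v_unit {u : R} (hu : IsUnit u) : w.v u = 0 := by
  obtain ⟨v, hv⟩ := hu.exists_right_inv
  have h := w.v_mul u v
  rw [hv, w.v_one] at h
  exact (add_eq_zero.mp h.symm).1

lemma v_neg (z : R) : w.v (-z) = w.v z := by
  have h := w.v_mul (-1) z
  rw [v_unit w (isUnit_one.neg), zero_add] at h
  simpa using h

lemma v_pow (z : R) (n : ℕ) : w.v (z ^ n) = n * w.v z := by
  induction n with
  | zero => simp [w.v_one]
  | succ n ih => rw [pow_succ, w.v_mul, ih]; push_cast; ring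

lemma v_sub (a b : R) : min (w.v a) (w.v b) ≤ w.v (a - b) := by
  have := w.v_add a (-b)
  rwa [v_neg, ← sub_eq_add_neg] at this

lemma v_add_eq {a b : R} (h : w.v a < w.v b) : w.v (a + b) = w.v a := by
  apply le_antisymm
  · by_contra hc
    push Not at hc
    have h1 := v_sub w (a + b) b
    rw [add_sub_cancel_right] at h1
    exact absurd (lt_of_lt_of_le (lt_min hc h) h1) (lt_irrefl _)
  · have := w.v_add a b
    rwa [min_eq_left h.le] at this

lemma exists_nat {z : R} (hz : z ≠ 0) : ∃ n : ℕ, w.v z = n := by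
  have : w.v z ≠ ⊤ := fun h => hz ((w.v_top_iff z).mp h)
  exact ⟨(w.v z).toNat, (ENat.coe_toNat this).symm⟩

/-- The valuation ideal of elements of value at least `n`. -/
def V (n : ℕ) : Ideal R where
  carrier := {z | (n : ℕ∞) ≤ w.v z}
  add_mem' := fun {a b} ha hb => le_trans (le_min ha hb) (w.v_add a b)
  zero_mem' := by simp [w.v_zero]
  smul_mem' := fun c z hz => by
    simp only [Set.mem_setOf_eq, smul_eq_mul, w.v_mul] at *
    exact hz.trans le_add_self

lemma mem_V {n : ℕ} {z : R} : z ∈ V w n ↔ (n : ℕ∞) ≤ w.v z := Iff.rfl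

lemma V_anti {a b : ℕ} (h : a ≤ b) : V w b ≤ V w a := fun z hz => by
  rw [mem_V] at *
  exact le_trans (by exact_mod_cast h) hz

lemma V_mul_le (a b : ℕ) : V w a * V w b ≤ V w (a + b) := by
  rw [Ideal.mul_le]
  intro r hr s hs
  rw [mem_V] at *
  rw [w.v_mul]; push_cast
  exact add_le_add hr hs

lemma pow_le_V {J : Ideal R} {a : ℕ} (h : J ≤ V w a) (n : ℕ) : J ^ n ≤ V w (n * a) := by
  induction n with
  | zero => intro z _; rw [mem_V]; simp
  | succ n ih =>
    rw [pow_succ, Nat.succ_mul]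
    exact (Ideal.mul_mono ih h).trans (V_mul_le w _ _)

end val

section param
variable {R : Type*} [CommRing R] [IsLocalRing R]

/-- Substitute for dimension at least two. -/
def NoPrin (R : Type*) [CommRing R] [IsLocalRing R] : Prop :=
  ∀ z ∈ maximalIdeal R, ∀ n : ℕ, ¬ (maximalIdeal R) ^ n ≤ Ideal.span {z}

variable {x y : R}

lemma par_swap (hM : maximalIdeal R = Ideal.span {x, y}) :
    maximalIdeal R = Ideal.span {y, x} := by rw [hM, Ideal.span_pair_comm]

lemma par_x (hM : maximalIdeal R = Ideal.span {x, y}) : x ∈ maximalIdeal R := by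
  rw [hM]; exact Ideal.subset_span (by simp)

lemma par_y (hM : maximalIdeal R = Ideal.span {x, y}) : y ∈ maximalIdeal R := by
  rw [hM]; exact Ideal.subset_span (by simp)

lemma par_shift (hM : maximalIdeal R = Ideal.span {x, y}) (b : R) :
    maximalIdeal R = Ideal.span {x, y - b * x} := by
  rw [hM]
  apply le_antisymm
  · rw [Ideal.span_le]
    rintro z (rfl | rfl)
    · exact Ideal.subset_span (by simp)
    · simp only [SetLike.mem_coe, Ideal.mem_span_pair]
      exact ⟨b, 1, by ring⟩
  · rw [Ideal.span_le]
    rintro z (rfl | rfl)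
    · exact Ideal.subset_span (by simp)
    · simp only [SetLike.mem_coe, Ideal.mem_span_pair]
      exact ⟨-b, 1, by ring⟩

lemma pow_split (hM : maximalIdeal R = Ideal.span {x, y}) (s : ℕ) {z : R}
    (hz : z ∈ (maximalIdeal R) ^ (s + 1)) :
    ∃ c, ∃ m ∈ (maximalIdeal R) ^ s, z = c * y ^ (s + 1) + x * m := by
  induction s generalizing z with
  | zero =>
    rw [zero_add, pow_one, hM, Ideal.mem_span_pair] at hz
    obtain ⟨a, b, rfl⟩ := hz
    exact ⟨b, a, by simp, by ring⟩
  | succ s ih =>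
    rw [pow_succ] at hz
    refine Submodule.mul_induction_on hz ?_ ?_
    · intro m hm n hn
      obtain ⟨c, m', hm', rfl⟩ := ih hm
      rw [hM, Ideal.mem_span_pair] at hn
      obtain ⟨a, b, rfl⟩ := hn
      refine ⟨c * b, a * (c * y ^ (s + 1) + x * m') + b * y * m', ?_, by ring⟩
      refine Ideal.add_mem _ (Ideal.mul_mem_left _ _ hm) ?_
      rw [pow_succ', mul_assoc]
      exact Ideal.mul_mem_left _ _ (Ideal.mul_mem_mul (par_y hM) hm')
    · rintro a b ⟨c, m, hm, rfl⟩ ⟨c', m', hm', rfl⟩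
      exact ⟨c + c', m + m', Ideal.add_mem _ hm hm', by ring⟩

open Polynomial in
lemma form (hM : maximalIdeal R = Ideal.span {x, y}) (s : ℕ) {z : R}
    (hz : z ∈ (maximalIdeal R) ^ s) :
    ∃ P : R[X], z = ∑ i ∈ Finset.range (s + 1), P.coeff i * y ^ i * x ^ (s - i) ∧
      P.natDegree ≤ s := by
  induction s generalizing z with
  | zero => exact ⟨C z, by simp, by simp⟩
  | succ s ih =>
    obtain ⟨c, m, hm, rfl⟩ := pow_split hM s hz
    obtain ⟨P, hP, hd⟩ := ih hm
    refine ⟨P + C c * X ^ (s + 1), ?_, ?_⟩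
    · rw [Finset.sum_range_succ, hP, Finset.mul_sum]
      have h0 : P.coeff (s + 1) = 0 := coeff_eq_zero_of_natDegree_lt (by omega)
      simp only [coeff_add, coeff_C_mul, coeff_X_pow, if_true, h0, mul_one, zero_add,
        Nat.sub_self, pow_zero]
      rw [add_comm]
      congr 1
      apply Finset.sum_congr rfl
      intro i hi
      rw [Finset.mem_range] at hi
      rw [if_neg (by omega), show s + 1 - i = (s - i) + 1 by omega]
      ring
    · refine (natDegree_add_le _ _).trans (max_le (by omega) ?_)
      exact (natDegree_C_mul_le _ _).trans (natDegree_X_pow_le _)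

open Polynomial in
lemma form_eval {s : ℕ} (P : R[X]) (hd : P.natDegree ≤ s) (b : R) :
    (y - b * x) ∣ (∑ i ∈ Finset.range (s + 1), P.coeff i * y ^ i * x ^ (s - i)) -
      P.eval b * x ^ s := by
  rw [eval_eq_sum_range' (Nat.lt_succ_of_le hd), Finset.sum_mul, ← Finset.sum_sub_distrib]
  apply Finset.dvd_sum
  intro i hi
  rw [Finset.mem_range] at hi
  have h1 : P.coeff i * y ^ i * x ^ (s - i) - P.coeff i * b ^ i * x ^ s
      = P.coeff i * x ^ (s - i) * (y ^ i - (b * x) ^ i) := by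
    have : x ^ s = x ^ (s - i) * x ^ i := by rw [← pow_add]; congr 1; omega
    rw [this]; ring
  rw [h1]
  exact Dvd.dvd.mul_left (sub_dvd_pow_sub_pow _ _ i) _

open Polynomial in
lemma form_mod {s : ℕ} (P : R[X]) :
    x ∣ (∑ i ∈ Finset.range (s + 1), P.coeff i * y ^ i * x ^ (s - i)) - P.coeff s * y ^ s := by
  rw [Finset.sum_range_succ]
  simp only [Nat.sub_self, pow_zero, mul_one, add_sub_cancel_right]
  apply Finset.dvd_sum
  intro i hi
  rw [Finset.mem_range] at hi
  exact Dvd.dvd.mul_left (dvd_pow_self _ (by omega)) _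

lemma mono_mem (hM : maximalIdeal R = Ideal.span {x, y}) {i s : ℕ} (h : i ≤ s) :
    y ^ i * x ^ (s - i) ∈ (maximalIdeal R) ^ s := by
  have : (maximalIdeal R) ^ s = (maximalIdeal R) ^ i * (maximalIdeal R) ^ (s - i) := by
    rw [← pow_add]; congr 1; omega
  rw [this]
  exact Ideal.mul_mem_mul (Ideal.pow_mem_pow (par_y hM) _) (Ideal.pow_mem_pow (par_x hM) _)

open Polynomial in
lemma form_map_ne (hM : maximalIdeal R = Ideal.span {x, y}) {s : ℕ} (P : R[X])
    (hz : (∑ i ∈ Finset.range (s + 1), P.coeff i * y ^ i * x ^ (s - i)) ∉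
      (maximalIdeal R) ^ (s + 1)) : P.map (residue R) ≠ 0 := by
  intro h
  apply hz
  apply Ideal.sum_mem
  intro i hi
  rw [Finset.mem_range] at hi
  have h1 : (P.map (residue R)).coeff i = 0 := by rw [h]; simp
  rw [coeff_map, residue_eq_zero_iff] at h1
  rw [mul_assoc, pow_succ']
  exact Ideal.mul_mem_mul h1 (mono_mem hM (by omega))

/-- generic line lemma -/
lemma generic (hM : maximalIdeal R = Ideal.span {x, y}) {s : ℕ} {z : R}
    (hz : z ∈ (maximalIdeal R) ^ s) (hz' : z ∉ (maximalIdeal R) ^ (s + 1)) :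
    ∃ p : Polynomial (ResidueField R), p ≠ 0 ∧ ∀ b : R, p.eval (residue R b) ≠ 0 →
      ∃ u, IsUnit u ∧ ∃ g, z = u * y ^ s + (x - b * y) * g := by
  obtain ⟨P, hP, hd⟩ := form (par_swap hM) s hz
  refine ⟨P.map (residue R), form_map_ne (par_swap hM) P (hP ▸ hz'), fun b hb => ?_⟩
  obtain ⟨g, hg⟩ := form_eval (x := y) (y := x) P hd b
  refine ⟨P.eval b, ?_, g, ?_⟩
  · rw [Polynomial.eval_map, Polynomial.eval₂_hom] at hb
    by_contra hu
    exact hb ((residue_eq_zero_iff _).mpr ((mem_maximalIdeal _).mpr hu))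
  · rw [← hP] at hg
    linear_combination hg

lemma y_pow_notMem (hM : maximalIdeal R = Ideal.span {x, y}) (hd : NoPrin R) (n : ℕ) :
    ¬ x ∣ y ^ n := by
  intro h
  rcases n with _ | n
  · rw [pow_zero] at h
    exact (mem_maximalIdeal _).mp (par_x hM) (isUnit_of_dvd_one h)
  apply hd x (par_x hM) (n + 1)
  intro z hz
  obtain ⟨c, m, hm, rfl⟩ := pow_split hM n hz
  rw [Ideal.mem_span_singleton]
  exact dvd_add (Dvd.dvd.mul_left h c) (Dvd.intro _ rfl)

lemma unit_y_notMem (hM : maximalIdeal R = Ideal.span {x, y}) (hd : NoPrin R) {n : ℕ} {u b : R}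
    (hu : IsUnit u) : u * y ^ n + x * b ∉ (maximalIdeal R) ^ (n + 1) := by
  intro h
  obtain ⟨c, m, hm, h⟩ := pow_split hM n h
  have h1 : x ∣ (u - c * y) * y ^ n := ⟨m - b, by linear_combination h⟩
  have h2 : IsUnit (u - c * y) := by
    by_contra h3
    have h4 : u - c * y ∈ maximalIdeal R := (mem_maximalIdeal _).mpr h3
    have h5 := Ideal.add_mem _ h4 (Ideal.mul_mem_left _ c (par_y hM))
    rw [sub_add_cancel] at h5
    exact (mem_maximalIdeal _).mp h5 hu
  exact y_pow_notMem hM hd n ((h2.dvd_mul_left).mp h1)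

lemma exists_avoid [IsAlgClosed (ResidueField R)] {p : Polynomial (ResidueField R)} (hp : p ≠ 0) :
    ∃ b : R, p.eval (residue R b) ≠ 0 := by
  haveI : Infinite (ResidueField R) := IsAlgClosed.instInfinite
  by_contra! h
  apply hp
  apply Polynomial.funext
  intro r
  obtain ⟨b, rfl⟩ := residue_surjective r
  simpa using h b

lemma ord_mul [IsAlgClosed (ResidueField R)] (hpar : ∃ x y : R, maximalIdeal R = Ideal.span {x, y})
    (hd : NoPrin R) {a b : ℕ} {f g : R}
    (hf : f ∈ (maximalIdeal R) ^ a) (hf' : f ∉ (maximalIdeal R) ^ (a + 1))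
    (hg : g ∈ (maximalIdeal R) ^ b) (hg' : g ∉ (maximalIdeal R) ^ (b + 1)) :
    f * g ∉ (maximalIdeal R) ^ (a + b + 1) := by
  obtain ⟨x, y, hM⟩ := hpar
  obtain ⟨p, hp, hp'⟩ := generic hM hf hf'
  obtain ⟨q, hq, hq'⟩ := generic hM hg hg'
  obtain ⟨c, hc⟩ := exists_avoid (mul_ne_zero hp hq)
  rw [Polynomial.eval_mul] at hc
  obtain ⟨u, hu, m, rfl⟩ := hp' c (left_ne_zero_of_mul hc)
  obtain ⟨v, hv, n, rfl⟩ := hq' c (right_ne_zero_of_mul hc)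
  have hM' := par_swap (par_shift (par_swap hM) c)
  have : (u * y ^ a + (x - c * y) * m) * (v * y ^ b + (x - c * y) * n)
    = (u * v) * y ^ (a + b) + (x - c * y) * (m * (v * y ^ b + (x - c * y) * n) + u * y ^ a * n) := by
    ring
  rw [this]
  exact unit_y_notMem hM' hd (hu.mul hv)

lemma ord_exists (w : DiscreteValuationOn R) (hpos : ∀ z ∈ maximalIdeal R, w.v z ≠ 0)
    {z : R} (hz : z ≠ 0) :
    ∃ s, z ∈ (maximalIdeal R) ^ s ∧ z ∉ (maximalIdeal R) ^ (s + 1) := by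
  obtain ⟨e, he⟩ := exists_nat w hz
  have h1 : maximalIdeal R ≤ V w 1 := fun m hm => by
    rw [mem_V]; exact_mod_cast ENat.one_le_iff_ne_zero.mpr (hpos m hm)
  have h2 : ∃ s, z ∉ (maximalIdeal R) ^ s := by
    refine ⟨e + 1, fun h => ?_⟩
    have := pow_le_V w h1 (e + 1) h
    rw [mem_V, he] at this
    have : (e + 1) * 1 ≤ e := by exact_mod_cast this
    omega
  classical
  have h3 := Nat.find_spec h2
  have h4 : Nat.find h2 ≠ 0 := by
    intro h; rw [h] at h3; simp at h3
  refine ⟨Nat.find h2 - 1, ?_, ?_⟩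
  · have := Nat.find_min h2 (m := Nat.find h2 - 1) (by omega)
    simpa using this
  · rwa [Nat.sub_add_cancel (by omega)]

/-- order of a product -/
lemma mem_of_mul_mem [IsAlgClosed (ResidueField R)] (w : DiscreteValuationOn R)
    (hpos : ∀ z ∈ maximalIdeal R, w.v z ≠ 0)
    (hpar : ∃ x y : R, maximalIdeal R = Ideal.span {x, y})
    (hd : NoPrin R) {a n : ℕ} {f g : R} (hf' : f ∉ (maximalIdeal R) ^ (a + 1))
    (h : f * g ∈ (maximalIdeal R) ^ (n + a)) : g ∈ (maximalIdeal R) ^ n := by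
  by_cases hg0 : g = 0
  · rw [hg0]; exact Ideal.zero_mem _
  have hf0 : f ≠ 0 := fun h0 => hf' (h0 ▸ Ideal.zero_mem _)
  obtain ⟨s, hs, hs'⟩ := ord_exists w hpos hf0
  obtain ⟨r, hr, hr'⟩ := ord_exists w hpos hg0
  have h1 := ord_mul hpar hd hs hs' hr hr'
  have h2 : s ≤ a := by
    by_contra hc
    exact hf' (Ideal.pow_le_pow_right (by omega) hs)
  by_contra hc
  have h3 : r < n := by
    by_contra h4
    exact hc (Ideal.pow_le_pow_right (by omega) hr)
  exact h1 (Ideal.pow_le_pow_right (by omega) h)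

lemma x_notMem_sq (hM : maximalIdeal R = Ideal.span {x, y}) (hd : NoPrin R) :
    x ∉ (maximalIdeal R) ^ (1 + 1) := by
  have := unit_y_notMem (par_swap hM) hd (n := 1) (b := 0) isUnit_one
  simpa using this

lemma colon_x_pow [IsAlgClosed (ResidueField R)] (w : DiscreteValuationOn R)
    (hpos : ∀ z ∈ maximalIdeal R, w.v z ≠ 0)
    (hM : maximalIdeal R = Ideal.span {x, y})
    (hd : NoPrin R) {n : ℕ} {g : R}
    (h : x * g ∈ (maximalIdeal R) ^ (n + 1)) : g ∈ (maximalIdeal R) ^ n :=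
  mem_of_mul_mem w hpos ⟨x, y, hM⟩ hd (x_notMem_sq hM hd) h

/-- choice of parameters -/
lemma choose_par [IsAlgClosed (ResidueField R)] (w : DiscreteValuationOn R)
    (hpar : ∃ x y : R, maximalIdeal R = Ideal.span {x, y})
    {s : ℕ} {z : R}
    (hz : z ∈ (maximalIdeal R) ^ s) (hz' : z ∉ (maximalIdeal R) ^ (s + 1)) :
    ∃ x y : R, maximalIdeal R = Ideal.span {x, y} ∧ (∀ m ∈ maximalIdeal R, w.v x ≤ w.v m) ∧
      ∃ u, IsUnit u ∧ ∃ g, z = u * y ^ s + x * g := by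
  obtain ⟨x, y, hM⟩ := hpar
  obtain ⟨p, hp, hp'⟩ := generic hM hz hz'
  have key : ∃ q : Polynomial (ResidueField R), q ≠ 0 ∧ ∀ b : R, q.eval (residue R b) ≠ 0 →
      w.v (x - b * y) ≤ min (w.v x) (w.v y) := by
    by_cases h : ∃ b0, min (w.v x) (w.v y) < w.v (x - b0 * y)
    · obtain ⟨b0, hb0⟩ := h
      refine ⟨Polynomial.X - Polynomial.C (residue R b0), Polynomial.X_sub_C_ne_zero _, ?_⟩
      intro b hb
      by_contra! hc
      simp only [Polynomial.eval_sub, Polynomial.eval_X, Polynomial.eval_C] at hb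
      rw [← map_sub] at hb
      have hu : IsUnit (b - b0) := by
        by_contra hu
        exact hb ((residue_eq_zero_iff _).mpr ((mem_maximalIdeal _).mpr hu))
      have h1 := v_sub w (x - b0 * y) (x - b * y)
      have h2 : x - b0 * y - (x - b * y) = (b - b0) * y := by ring
      rw [h2, w.v_mul, v_unit w hu, zero_add] at h1
      have h3 : min (w.v x) (w.v y) < w.v y := lt_of_lt_of_le (lt_min hb0 hc) h1
      have h4 := w.v_add (x - b * y) (b * y)
      rw [sub_add_cancel] at h4
      have h5 : w.v y ≤ w.v (b * y) := by rw [w.v_mul]; exact le_add_self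
      have h6 : min (w.v x) (w.v y) < w.v x :=
        lt_of_lt_of_le (lt_min hc (h3.trans_le h5)) h4
      exact absurd (lt_min h6 h3) (lt_irrefl _)
    · push Not at h
      exact ⟨1, one_ne_zero, fun b _ => h b⟩
  obtain ⟨q, hq, hq'⟩ := key
  obtain ⟨c, hc⟩ := exists_avoid (mul_ne_zero hp hq)
  rw [Polynomial.eval_mul] at hc
  refine ⟨x - c * y, y, par_swap (par_shift (par_swap hM) c), ?_, hp' c (left_ne_zero_of_mul hc)⟩
  intro m hm
  refine (hq' c (right_ne_zero_of_mul hc)).trans ?_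
  rw [hM, Ideal.mem_span_pair] at hm
  obtain ⟨a, b, rfl⟩ := hm
  refine le_trans ?_ (w.v_add _ _)
  rw [w.v_mul, w.v_mul]
  exact min_le_min le_add_self le_add_self

end param

section noeth
variable {R : Type*} [CommRing R] [IsLocalRing R] [IsNoetherianRing R] {x y : R}

lemma quot_form (hM : maximalIdeal R = Ideal.span {x, y}) {c : R} (hc : ¬ x ∣ c) :
    ∃ i u b, IsUnit u ∧ c = u * y ^ i + x * b := by
  classical
  have h1 : ∃ e, c ∉ Ideal.span {x} ⊔ (maximalIdeal R) ^ e := by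
    by_contra! h
    haveI : Nontrivial (R ⧸ Ideal.span {x}) := Ideal.Quotient.nontrivial_iff.mpr (by
      rw [Ne, Ideal.span_singleton_eq_top]
      exact (mem_maximalIdeal _).mp (par_x hM))
    haveI : IsLocalRing (R ⧸ Ideal.span {x}) :=
      IsLocalRing.of_surjective' (Ideal.Quotient.mk _) Ideal.Quotient.mk_surjective
    have hx : Ideal.span {x} ≤ maximalIdeal R := by
      rw [Ideal.span_singleton_le_iff_mem]; exact par_x hM
    have h2 := Ideal.iInf_pow_eq_bot_of_isLocalRing
      (Ideal.map (Ideal.Quotient.mk (Ideal.span {x})) (maximalIdeal R)) (by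
        intro ht
        have h5 := Ideal.comap_map_mk hx
        rw [ht, Ideal.comap_top] at h5
        exact (Ideal.IsPrime.ne_top' (I := maximalIdeal R)) h5.symm)
    have h3 : Ideal.Quotient.mk (Ideal.span {x}) c ∈
        (⨅ i : ℕ, (Ideal.map (Ideal.Quotient.mk (Ideal.span {x})) (maximalIdeal R)) ^ i) := by
      rw [Ideal.mem_iInf]
      intro e
      obtain ⟨a, ha, b, hb, hab⟩ := Submodule.mem_sup.mp (h e)
      rw [← hab, map_add, Ideal.Quotient.eq_zero_iff_mem.mpr ha, zero_add]
      have h4 := Ideal.mem_map_of_mem (Ideal.Quotient.mk (Ideal.span {x})) hb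
      rwa [Ideal.map_pow] at h4
    rw [h2] at h3
    apply hc
    rwa [Ideal.mem_bot, Ideal.Quotient.eq_zero_iff_mem, Ideal.mem_span_singleton] at h3
  have h3 := Nat.find_spec h1
  have h4 : Nat.find h1 ≠ 0 := by
    intro h; rw [h] at h3; simp at h3
  obtain ⟨e, he⟩ := Nat.exists_eq_succ_of_ne_zero h4
  rw [he] at h3
  have h5 := Nat.find_min h1 (m := e) (by omega)
  rw [not_not] at h5
  obtain ⟨a, ha, m, hm, rfl⟩ := Submodule.mem_sup.mp h5
  obtain ⟨a, rfl⟩ := Ideal.mem_span_singleton.mp ha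
  obtain ⟨P, hP, -⟩ := form hM e hm
  obtain ⟨b, hb⟩ := form_mod (x := x) (y := y) (s := e) P
  rw [← hP] at hb
  refine ⟨e, P.coeff e, a + b, ?_, by linear_combination hb⟩
  by_contra hu
  apply h3
  have : x * a + m = x * (a + b) + P.coeff e * y ^ e := by linear_combination hb
  rw [this, Nat.succ_eq_add_one, pow_succ']
  exact Submodule.add_mem_sup (Ideal.mem_span_singleton.mpr (Dvd.intro _ rfl))
    (Ideal.mul_mem_mul ((mem_maximalIdeal _).mpr hu) (Ideal.pow_mem_pow (par_y hM) _))

lemma x_prime [IsDomain R] (hM : maximalIdeal R = Ideal.span {x, y}) (hd : NoPrin R) : Prime x := by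
  refine ⟨?_, (mem_maximalIdeal _).mp (par_x hM), ?_⟩
  · intro h
    have := x_notMem_sq hM hd
    rw [h] at this
    exact this (Ideal.zero_mem _)
  · intro a b hab
    by_contra! hc
    obtain ⟨i, u, g, hu, rfl⟩ := quot_form hM hc.1
    obtain ⟨j, v, g', hv, rfl⟩ := quot_form hM hc.2
    have h1 : x ∣ (u * v) * y ^ (i + j) := by
      have h2 : (u * v) * y ^ (i + j) = (u * y ^ i + x * g) * (v * y ^ j + x * g')
        - x * (g * (v * y ^ j + x * g') + u * y ^ i * g') := by ring
      rw [h2]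
      exact dvd_sub hab (Dvd.intro _ rfl)
    exact y_pow_notMem hM hd _ (((hu.mul hv).dvd_mul_left).mp h1)

lemma not_dvd_y (hM : maximalIdeal R = Ideal.span {x, y}) (hd : NoPrin R) : ¬ x ∣ y := by
  have := y_pow_notMem hM hd 1
  rwa [pow_one] at this

end noeth
end DegOne

namespace DegOne

section len
variable {R : Type*} [CommRing R]

lemma length_colon (A : Ideal R) (g : R) :
    Module.length R (R ⧸ A) =
      Module.length R (R ⧸ (Submodule.colon A {g})) + Module.length R (R ⧸ (A ⊔ Ideal.span {g})) := by
  let B : Ideal R := Submodule.colon A {g}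
  have hB : ∀ z, z ∈ B ↔ z * g ∈ A := fun z => by
    simp only [B, Submodule.mem_colon_singleton, smul_eq_mul]
  let f0 : R →ₗ[R] R := LinearMap.mulRight R g
  have hf0 : B ≤ Submodule.comap f0 A := fun z hz => by
    simpa [f0] using (hB z).mp hz
  let f : (R ⧸ B) →ₗ[R] (R ⧸ A) := Submodule.mapQ B A f0 hf0
  let h : (R ⧸ A) →ₗ[R] (R ⧸ (A ⊔ Ideal.span {g})) := Submodule.factor le_sup_left
  refine Module.length_eq_add_of_exact f h ?_ ?_ ?_
  · rw [← LinearMap.ker_eq_bot, LinearMap.ker_eq_bot']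
    intro z hz
    obtain ⟨z, rfl⟩ := Submodule.mkQ_surjective _ z
    simp only [f, Submodule.mkQ_apply, Submodule.mapQ_apply, Submodule.Quotient.mk_eq_zero] at hz ⊢
    rw [hB]; simpa [f0] using hz
  · exact Submodule.factor_surjective _
  · intro z
    obtain ⟨z, rfl⟩ := Submodule.mkQ_surjective _ z
    constructor
    · intro hz
      have hz : (Submodule.Quotient.mk z : R ⧸ (A ⊔ Ideal.span {g})) = 0 := hz
      rw [Submodule.Quotient.mk_eq_zero] at hz
      obtain ⟨a, ha, b, hb, rfl⟩ := Submodule.mem_sup.mp hz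
      obtain ⟨c, rfl⟩ := Ideal.mem_span_singleton'.mp hb
      refine ⟨Submodule.Quotient.mk c, ?_⟩
      simp only [f, Submodule.mapQ_apply, Submodule.mkQ_apply, f0, LinearMap.mulRight_apply]
      rw [Submodule.Quotient.eq]
      have : c * g - (a + c * g) = -a := by ring
      rw [this]; exact A.neg_mem ha
    · rintro ⟨c, hc⟩
      obtain ⟨c, rfl⟩ := Submodule.mkQ_surjective _ c
      rw [← hc]
      simp only [f, h, Submodule.mapQ_apply, Submodule.mkQ_apply, f0, LinearMap.mulRight_apply,
        Submodule.factor_mk, Submodule.Quotient.mk_eq_zero]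
      exact Ideal.mem_sup_right (Ideal.mul_mem_left _ _ (Ideal.mem_span_singleton_self g))

lemma length_quot_maximal (A : Ideal R) [hA : A.IsMaximal] : Module.length R (R ⧸ A) = 1 := by
  haveI : IsSimpleModule R (R ⧸ A) := isSimpleModule_iff_isCoatom.mpr (Ideal.isMaximal_def.mp hA)
  exact Module.length_eq_one R _

lemma length_quot_top : Module.length R (R ⧸ (⊤ : Ideal R)) = 0 := by
  haveI : Subsingleton (R ⧸ (⊤ : Ideal R)) := Ideal.Quotient.subsingleton_iff.mpr rfl
  exact Module.length_eq_zero

lemma moduleLength_eq (M : Type*) [AddCommGroup M] [Module R M] :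
    moduleLength R M = Module.length R M := by
  apply WithBot.coe_injective
  rw [Module.coe_length]
  unfold moduleLength
  apply le_antisymm
  · rw [← Module.coe_length]
    rw [WithBot.coe_le_coe]
    apply iSup_le; intro n
    apply iSup_le; rintro ⟨c, hc⟩
    rw [← WithBot.coe_le_coe, Module.coe_length]
    exact Order.LTSeries.length_le_krullDim (LTSeries.mk n c hc)
  · unfold Order.krullDim
    apply iSup_le
    intro p
    have : ((p.length : ℕ∞)) ≤ ⨆ (n : ℕ) (_ : ∃ c : Fin (n + 1) → Submodule R M, StrictMono c), (n : ℕ∞) :=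
      le_iSup₂_of_le p.length ⟨p, p.strictMono⟩ le_rfl
    exact_mod_cast this

lemma length_pi_pow [IsDomain R] {p : R} (hp : p ≠ 0) (hm : (Ideal.span {p}).IsMaximal) (s : ℕ) :
    Module.length R (R ⧸ Ideal.span {p ^ s}) = s := by
  induction s with
  | zero =>
    have : Ideal.span {p ^ 0} = (⊤ : Ideal R) := by simp
    rw [this, length_quot_top]; simp
  | succ s ih =>
    rw [length_colon _ p]
    have h1 : Submodule.colon (Ideal.span {p ^ (s + 1)}) {p} = Ideal.span {p ^ s} := by
      ext z
      rw [Submodule.mem_colon_singleton, smul_eq_mul, Ideal.mem_span_singleton,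
        Ideal.mem_span_singleton, pow_succ]
      exact mul_dvd_mul_iff_right hp
    have h2 : Ideal.span {p ^ (s + 1)} ⊔ Ideal.span {p} = Ideal.span {p} := by
      rw [sup_eq_right, Ideal.span_singleton_le_span_singleton]
      exact dvd_pow_self _ (by omega)
    rw [h1, h2, ih, length_quot_maximal]; push_cast; rfl

end len

section ord
variable {R : Type*} [CommRing R] [IsLocalRing R]

/-- The order of the ideal `J` along the curve `x = 0` with parameter `y`. -/
def OrdAt (x y : R) (J : Ideal R) (s : ℕ) : Prop :=
  J ≤ Ideal.span {x} ⊔ Ideal.span {y ^ s} ∧ ∃ a ∈ J, ∃ u b, IsUnit u ∧ a = u * y ^ s + x * b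

variable {x y : R} {J K : Ideal R}

lemma mem_sup_span {s : ℕ} {z : R} :
    z ∈ Ideal.span {x} ⊔ Ideal.span {y ^ s} ↔ ∃ c b, z = c * y ^ s + x * b := by
  rw [← Ideal.span_insert, Ideal.mem_span_pair]
  constructor
  · rintro ⟨a, b, rfl⟩; exact ⟨b, a, by ring⟩
  · rintro ⟨a, b, rfl⟩; exact ⟨b, a, by ring⟩

lemma OrdAt.mono (hM : maximalIdeal R = Ideal.span {x, y}) (hd : NoPrin R) {s t : ℕ}
    (hJ : OrdAt x y J s) (hK : OrdAt x y K t) (h : J ≤ K) : t ≤ s := by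
  obtain ⟨a, ha, u, b, hu, rfl⟩ := hJ.2
  obtain ⟨c, b', hc⟩ := mem_sup_span.mp (hK.1 (h ha))
  by_contra! hst
  apply unit_y_notMem hM hd (n := s) (u := u) (b := b - b') hu
  have : u * y ^ s + x * (b - b') = c * y ^ t := by linear_combination hc
  rw [this]
  exact Ideal.mul_mem_left _ _ (Ideal.pow_le_pow_right hst (Ideal.pow_mem_pow (par_y hM) _))

lemma OrdAt.unique (hM : maximalIdeal R = Ideal.span {x, y}) (hd : NoPrin R) {s t : ℕ}
    (hJ : OrdAt x y J s) (hK : OrdAt x y J t) : s = t :=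
  le_antisymm (hK.mono hM hd hJ le_rfl) (hJ.mono hM hd hK le_rfl)

lemma OrdAt.mul {s t : ℕ}
    (hJ : OrdAt x y J s) (hK : OrdAt x y K t) : OrdAt x y (J * K) (s + t) := by
  constructor
  · rw [Ideal.mul_le]
    intro r hr q hq
    obtain ⟨c, b, rfl⟩ := mem_sup_span.mp (hJ.1 hr)
    obtain ⟨c', b', rfl⟩ := mem_sup_span.mp (hK.1 hq)
    rw [mem_sup_span]
    exact ⟨c * c', c * y ^ s * b' + b * (c' * y ^ t + x * b'), by ring⟩
  · obtain ⟨a, ha, u, b, hu, rfl⟩ := hJ.2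
    obtain ⟨a', ha', u', b', hu', rfl⟩ := hK.2
    exact ⟨_, Ideal.mul_mem_mul ha ha', u * u', u * y ^ s * b' + b * (u' * y ^ t + x * b'),
      hu.mul hu', by ring⟩

lemma OrdAt.top : OrdAt x y (⊤ : Ideal R) 0 := by
  refine ⟨by simp, 1, trivial, 1, 0, isUnit_one, by simp⟩

lemma OrdAt.pow {s : ℕ} (hJ : OrdAt x y J s) (n : ℕ) : OrdAt x y (J ^ n) (n * s) := by
  induction n with
  | zero => simpa using OrdAt.top
  | succ n ih => rw [pow_succ, Nat.succ_mul]; exact ih.mul hJ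

lemma OrdAt.exists [IsNoetherianRing R] (hM : maximalIdeal R = Ideal.span {x, y})
    (h : ∃ z ∈ J, ¬ x ∣ z) : ∃ s, OrdAt x y J s := by
  classical
  obtain ⟨z, hz, hxz⟩ := h
  have h1 : ∃ s, ∃ a ∈ J, ∃ u b, IsUnit u ∧ a = u * y ^ s + x * b := by
    obtain ⟨i, u, b, hu, h⟩ := quot_form hM hxz
    exact ⟨i, z, hz, u, b, hu, h⟩
  refine ⟨Nat.find h1, ?_, Nat.find_spec h1⟩
  intro c hc
  rw [mem_sup_span]
  by_cases hxc : x ∣ c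
  · obtain ⟨b, rfl⟩ := hxc
    exact ⟨0, b, by ring⟩
  · obtain ⟨i, u, b, hu, h⟩ := quot_form hM hxc
    have h2 : Nat.find h1 ≤ i := Nat.find_min' h1 ⟨c, hc, u, b, hu, h⟩
    refine ⟨u * y ^ (i - Nat.find h1), b, ?_⟩
    rw [h, mul_assoc, ← pow_add, Nat.sub_add_cancel h2]

lemma OrdAt.sup_eq {s : ℕ} (hJ : OrdAt x y J s) :
    J ⊔ Ideal.span {x} = Ideal.span {x} ⊔ Ideal.span {y ^ s} := by
  apply le_antisymm
  · exact sup_le hJ.1 le_sup_left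
  · refine sup_le le_sup_right ?_
    rw [Ideal.span_singleton_le_iff_mem]
    obtain ⟨a, ha, u, b, hu, rfl⟩ := hJ.2
    obtain ⟨v, hv⟩ := hu.exists_left_inv
    have : y ^ s = v * (u * y ^ s + x * b) + (-(v * b)) * x := by
      linear_combination (-y ^ s) * hv
    rw [this]
    exact Submodule.add_mem_sup (Ideal.mul_mem_left _ _ ha)
      (Ideal.mul_mem_left _ _ (Ideal.mem_span_singleton_self x))

lemma length_par [IsDomain R] [IsNoetherianRing R] (hM : maximalIdeal R = Ideal.span {x, y})
    (hd : NoPrin R) (s : ℕ) :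
    Module.length R (R ⧸ (Ideal.span {x} ⊔ Ideal.span {y ^ s})) = s := by
  have hx := x_prime hM hd
  induction s with
  | zero =>
    have : Ideal.span {x} ⊔ Ideal.span {y ^ 0} = (⊤ : Ideal R) := by simp
    rw [this, length_quot_top]; simp
  | succ s ih =>
    rw [length_colon _ y]
    have h1 : Submodule.colon (Ideal.span {x} ⊔ Ideal.span {y ^ (s + 1)}) {y} =
        Ideal.span {x} ⊔ Ideal.span {y ^ s} := by
      ext z
      rw [Submodule.mem_colon_singleton, smul_eq_mul, mem_sup_span, mem_sup_span]
      constructor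
      · rintro ⟨c, b, h⟩
        have h2 : x ∣ (z - c * y ^ s) * y := ⟨b, by linear_combination h⟩
        obtain ⟨b', hb'⟩ := (hx.dvd_or_dvd h2).resolve_right (not_dvd_y hM hd)
        exact ⟨c, b', by linear_combination hb'⟩
      · rintro ⟨c, b, rfl⟩
        exact ⟨c, b * y, by ring⟩
    have h2 : Ideal.span {x} ⊔ Ideal.span {y ^ (s + 1)} ⊔ Ideal.span {y} = maximalIdeal R := by
      rw [hM, Ideal.span_insert]
      apply le_antisymm
      · refine sup_le (sup_le le_sup_left ?_) le_sup_right
        refine le_trans ?_ le_sup_right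
        rw [Ideal.span_singleton_le_span_singleton]
        exact dvd_pow_self _ (by omega)
      · exact sup_le (le_sup_left.trans le_sup_left) le_sup_right
    rw [h1, h2, ih, length_quot_maximal]; push_cast; rfl

end ord

section rel
variable {R : Type*} [CommRing R] [IsLocalRing R] [IsNoetherianRing R]

/-- Every `V (m N)` has reduction `(V N)^m`. -/
def Red (w : DiscreteValuationOn R) (N : ℕ) : Prop :=
  ∀ m : ℕ, ∃ k : ℕ, V w (m * N) ^ (k + 1) ≤ V w N ^ m * V w (m * N) ^ k

variable (w : DiscreteValuationOn R)

lemma max_le_V (hpos : ∀ z ∈ maximalIdeal R, w.v z ≠ 0) : maximalIdeal R ≤ V w 1 := fun m hm => by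
  rw [mem_V]; exact_mod_cast ENat.one_le_iff_ne_zero.mpr (hpos m hm)

lemma max_pow_le_V (hpos : ∀ z ∈ maximalIdeal R, w.v z ≠ 0) (n : ℕ) : maximalIdeal R ^ n ≤ V w n := by
  have := pow_le_V w (max_le_V w hpos) n
  rwa [mul_one] at this

variable {x y : R}

lemma V_ord (hpos : ∀ z ∈ maximalIdeal R, w.v z ≠ 0) (hM : maximalIdeal R = Ideal.span {x, y}) (hd : NoPrin R) (n : ℕ) :
    ∃ s, OrdAt x y (V w n) s :=
  OrdAt.exists hM ⟨y ^ n, max_pow_le_V w hpos n (Ideal.pow_mem_pow (par_y hM) n),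
    y_pow_notMem hM hd n⟩

lemma V_ord_mul (hpos : ∀ z ∈ maximalIdeal R, w.v z ≠ 0) (hM : maximalIdeal R = Ideal.span {x, y}) (hd : NoPrin R) {N s : ℕ}
    (hred : Red w N) (h : OrdAt x y (V w N) s) (m : ℕ) : OrdAt x y (V w (m * N)) (m * s) := by
  obtain ⟨σ, hσ⟩ := V_ord w hpos hM hd (m * N)
  obtain ⟨k, hk⟩ := hred m
  have h1 := OrdAt.mono hM hd (h.pow m) hσ (pow_le_V w le_rfl m)
  have h2 := OrdAt.mono hM hd (hσ.pow (k + 1)) ((h.pow m).mul (hσ.pow k)) hk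
  have h3 : (k + 1) * σ = σ + k * σ := by ring
  have : σ = m * s := by omega
  rwa [← this]

lemma length_step [IsDomain R] (hM : maximalIdeal R = Ideal.span {x, y}) (hd : NoPrin R) {A : ℕ}
    (hx : w.v x = A) {n s : ℕ} (hs : OrdAt x y (V w (n + A)) s) :
    Module.length R (R ⧸ V w (n + A)) = Module.length R (R ⧸ V w n) + s := by
  have h1 : Submodule.colon (V w (n + A)) {x} = V w n := by
    ext z
    rw [Submodule.mem_colon_singleton, smul_eq_mul, mem_V, mem_V, w.v_mul, hx]
    push_cast
    exact ENat.add_le_add_iff_right (ENat.coe_ne_top A)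
  rw [length_colon _ x, hs.sup_eq, length_par hM hd, h1]

lemma V_zero : V w 0 = ⊤ := by
  rw [eq_top_iff]; intro z _; rw [mem_V]; simp

lemma length_V_ne_top (hpos : ∀ z ∈ maximalIdeal R, w.v z ≠ 0) [IsDomain R] (hM : maximalIdeal R = Ideal.span {x, y}) (hd : NoPrin R) {A : ℕ}
    (hx : w.v x = A) (n : ℕ) : Module.length R (R ⧸ V w n) ≠ ⊤ := by
  have hA : 1 ≤ A := by
    have := hpos x (par_x hM)
    rw [hx] at this
    have : A ≠ 0 := by exact_mod_cast this
    omega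
  have key : ∀ j : ℕ, Module.length R (R ⧸ V w (j * A)) ≠ ⊤ := by
    intro j
    induction j with
    | zero => rw [zero_mul, V_zero, length_quot_top]; simp
    | succ j ih =>
      rw [Nat.succ_mul]
      obtain ⟨s, hs⟩ := V_ord w hpos hM hd (j * A + A)
      rw [length_step w hM hd hx hs]
      exact WithTop.add_ne_top.mpr ⟨ih, ENat.coe_ne_top s⟩
  have h1 : V w (n * A) ≤ V w n := V_anti w (by nlinarith)
  have := Module.length_le_of_surjective (Submodule.factor h1) (Submodule.factor_surjective _)
  exact ne_top_of_le_ne_top (key n) this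

/-- upper and lower bound of the length between `V n` and `V (n + k A)`. -/
lemma length_bounds (hpos : ∀ z ∈ maximalIdeal R, w.v z ≠ 0) [IsDomain R] (hM : maximalIdeal R = Ideal.span {x, y}) (hd : NoPrin R) {A : ℕ}
    (hx : w.v x = A) {n s t q : ℕ} (hs : OrdAt x y (V w n) s) (k : ℕ) (hq : n + k * A ≤ q)
    (ht : OrdAt x y (V w q) t) :
    Module.length R (R ⧸ V w n) + (k * s : ℕ) ≤ Module.length R (R ⧸ V w (n + k * A)) ∧
    Module.length R (R ⧸ V w (n + k * A)) ≤ Module.length R (R ⧸ V w n) + (k * t : ℕ) := by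
  induction k with
  | zero =>
    have h0 : n + 0 * A = n := by omega
    rw [h0]; simp
  | succ k ih =>
    have h1 : n + (k + 1) * A = n + k * A + A := by ring
    obtain ⟨σ, hσ⟩ := V_ord w hpos hM hd (n + k * A + A)
    have h2 := hσ.mono hM hd hs (V_anti w (by omega))
    have h3 := ht.mono hM hd hσ (V_anti w (by omega))
    obtain ⟨i1, i2⟩ := ih (by omega)
    rw [h1, length_step w hM hd hx hσ]
    have e1 : ((k + 1) * s : ℕ) = k * s + s := by ring
    have e2 : ((k + 1) * t : ℕ) = k * t + t := by ring
    rw [e1, e2, Nat.cast_add, Nat.cast_add, ← add_assoc, ← add_assoc]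
    exact ⟨add_le_add i1 (by exact_mod_cast h2), add_le_add i2 (by exact_mod_cast h3)⟩

variable {f g f' g' : R}

lemma rel_le (hpos : ∀ z ∈ maximalIdeal R, w.v z ≠ 0) [IsDomain R] (hM : maximalIdeal R = Ideal.span {f, g})
    (hM' : maximalIdeal R = Ideal.span {f', g'}) (hd : NoPrin R) {A B N s s' : ℕ}
    (hN : 0 < N) (hred : Red w N)
    (hA : w.v f = A) (hB : w.v f' = B) (hs : OrdAt f g (V w N) s) (hs' : OrdAt f' g' (V w N) s') :
    B * s ≤ A * s' := by
  have key : ∀ m : ℕ, B * (m * s) ≤ A * ((m + A * B) * s') := by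
    intro m
    have o1 := V_ord_mul w hpos hM hd hred hs m
    have o2 := V_ord_mul w hpos hM hd hred hs (m + A * B)
    have o1' := V_ord_mul w hpos hM' hd hred hs' m
    have o2' := V_ord_mul w hpos hM' hd hred hs' (m + A * B)
    have hq : m * N + B * A ≤ (m + A * B) * N := by
      nlinarith [Nat.zero_le (A * B), Nat.mul_le_mul_left (A*B) hN]
    have b1 := (length_bounds w hpos hM hd hA o1 B hq o2).1
    have b2 := (length_bounds w hpos hM' hd hB o1' A (by rw [mul_comm B A] at hq; exact hq) o2').2
    rw [mul_comm A B] at b2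
    have b3 := b1.trans b2
    rw [mul_comm B A] at b3
    have := (ENat.add_le_add_iff_left (length_V_ne_top w hpos hM hd hA (m * N))).mp b3
    exact_mod_cast this
  by_contra! hlt
  have := key (A * (A * B) * s' + 1)
  nlinarith [this, hlt, Nat.mul_le_mul_right (A * (A * B) * s' + 1) (Nat.succ_le_of_lt hlt)]

lemma rel_eq (hpos : ∀ z ∈ maximalIdeal R, w.v z ≠ 0) [IsDomain R] (hM : maximalIdeal R = Ideal.span {f, g})
    (hM' : maximalIdeal R = Ideal.span {f', g'}) (hd : NoPrin R) {A B N s s' : ℕ}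
    (hN : 0 < N) (hred : Red w N)
    (hA : w.v f = A) (hB : w.v f' = B) (hs : OrdAt f g (V w N) s) (hs' : OrdAt f' g' (V w N) s') :
    B * s = A * s' :=
  le_antisymm (rel_le w hpos hM hM' hd hN hred hA hB hs hs')
    (rel_le w hpos hM' hM hd hN hred hB hA hs' hs)

end rel
end DegOne

namespace DegOne

section ctr
variable {R : Type*} [CommRing R] [IsLocalRing R]

/-- Contracted ideals (with respect to `x`, with `y` a second parameter). -/
def Ctr (x y : R) (J : Ideal R) (s : ℕ) : Prop :=
  OrdAt x y J s ∧ ∀ g, x * g ∈ J → y * g ∈ J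

variable {x y : R} {J K : Ideal R}

lemma OrdAt.decomp {s : ℕ} (hJ : J ≤ Ideal.span {x} ⊔ Ideal.span {y ^ s}) {a u b : R} (ha : a ∈ J)
    (hu : IsUnit u) (hab : a = u * y ^ s + x * b) {j : R} (hj : j ∈ J) :
    ∃ c q, j = c * a + x * q ∧ x * q ∈ J := by
  obtain ⟨c, b', h⟩ := mem_sup_span.mp (hJ hj)
  obtain ⟨v, hv⟩ := hu.exists_left_inv
  have e : x * (b' - c * v * b) = j - c * v * a := by
    rw [h, hab]; linear_combination (-c * y ^ s) * (-hv)
  refine ⟨c * v, b' - c * v * b, ?_, ?_⟩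
  · rw [e]; ring
  · rw [e]; exact J.sub_mem hj (J.mul_mem_left _ ha)

variable [IsDomain R] [IsNoetherianRing R]

lemma not_dvd_unit_y (hM : maximalIdeal R = Ideal.span {x, y}) (hd : NoPrin R) {s : ℕ} {a u b : R}
    (hu : IsUnit u) (hab : a = u * y ^ s + x * b) : ¬ x ∣ a := by
  intro h
  have h1 : x ∣ u * y ^ s := by
    have := dvd_sub h (Dvd.intro b rfl)
    rw [hab] at this; simpa using this
  rw [hu.dvd_mul_left] at h1
  exact y_pow_notMem hM hd s h1

lemma Ctr.mul (hM : maximalIdeal R = Ideal.span {x, y}) (hd : NoPrin R) {s t : ℕ}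
    (hJ : Ctr x y J s) (hK : Ctr x y K t) : Ctr x y (J * K) (s + t) := by
  refine ⟨hJ.1.mul hK.1, ?_⟩
  have hxp := x_prime hM hd
  obtain ⟨a, ha, u, b, hu, hab⟩ := hJ.1.2
  obtain ⟨a', ha', u', b', hu', hab'⟩ := hK.1.2
  have key : ∀ z ∈ J * K, ∃ c q, z = c * (a * a') + x * q ∧ y * q ∈ J * K := by
    intro z hz
    induction hz using Submodule.mul_induction_on' with
    | mem_mul_mem m hm n hn =>
      obtain ⟨c, p, h1, h2⟩ := OrdAt.decomp hJ.1.1 ha hu hab hm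
      obtain ⟨c', q, h1', h2'⟩ := OrdAt.decomp hK.1.1 ha' hu' hab' hn
      refine ⟨c * c', c * a * q + c' * a' * p + x * p * q, by rw [h1, h1']; ring, ?_⟩
      have e : y * (c * a * q + c' * a' * p + x * p * q) =
        c * (a * (y * q)) + c' * ((y * p) * a') + (x * p) * (y * q) := by ring
      rw [e]
      exact Ideal.add_mem _ (Ideal.add_mem _
        (Ideal.mul_mem_left _ _ (Ideal.mul_mem_mul ha (hK.2 _ h2')))
        (Ideal.mul_mem_left _ _ (Ideal.mul_mem_mul (hJ.2 _ h2) ha')))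
        (Ideal.mul_mem_mul h2 (hK.2 _ h2'))
    | add m _ n _ h h' =>
      obtain ⟨c, q, h1, h2⟩ := h
      obtain ⟨c', q', h1', h2'⟩ := h'
      refine ⟨c + c', q + q', by rw [h1, h1']; ring, ?_⟩
      rw [mul_add]; exact Ideal.add_mem _ h2 h2'
  intro g hg
  obtain ⟨c, q, h1, h2⟩ := key _ hg
  have h3 : x ∣ c * (a * a') := ⟨g - q, by linear_combination -h1⟩
  have h4 : x ∣ c := by
    rcases hxp.dvd_or_dvd h3 with h | h
    · exact h
    · rcases hxp.dvd_or_dvd h with h | h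
      · exact absurd h (not_dvd_unit_y hM hd hu hab)
      · exact absurd h (not_dvd_unit_y hM hd hu' hab')
  obtain ⟨c', rfl⟩ := h4
  have h5 : g = c' * (a * a') + q := by
    apply mul_left_cancel₀ hxp.ne_zero
    rw [h1]; ring
  rw [h5, mul_add]
  refine Ideal.add_mem _ ?_ h2
  rw [← mul_assoc]
  exact Ideal.mul_mem_left _ _ (Ideal.mul_mem_mul ha ha')

lemma Ctr.max (hM : maximalIdeal R = Ideal.span {x, y}) : Ctr x y (maximalIdeal R) 1 := by
  refine ⟨⟨?_, y, par_y hM, 1, 0, isUnit_one, by simp⟩, fun g _ => Ideal.mul_mem_right _ _ (par_y hM)⟩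
  rw [hM, Ideal.span_insert, pow_one]

lemma Ctr.top : Ctr x y (⊤ : Ideal R) 0 := ⟨OrdAt.top, fun _ _ => trivial⟩

lemma Ctr.max_pow (hM : maximalIdeal R = Ideal.span {x, y}) (hd : NoPrin R) (n : ℕ) :
    Ctr x y (maximalIdeal R ^ n) n := by
  induction n with
  | zero => rw [pow_zero, Ideal.one_eq_top]; exact Ctr.top
  | succ n ih => rw [pow_succ]; exact ih.mul hM hd (Ctr.max hM)

lemma Ctr.colon_M (hM : maximalIdeal R = Ideal.span {x, y}) (hd : NoPrin R) {s : ℕ}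
    (hJ : Ctr x y J s) {g : R} (hg : x * g ∈ maximalIdeal R * J) : g ∈ J := by
  have hxp := x_prime hM hd
  have h1 : ∃ j₁ ∈ J, ∃ j₂ ∈ J, x * g = x * j₁ + y * j₂ := by
    rw [hM, Ideal.span_insert, Ideal.sup_mul] at hg
    obtain ⟨p, hp, q, hq, h⟩ := Submodule.mem_sup.mp hg
    obtain ⟨j₁, h₁, rfl⟩ := Ideal.mem_span_singleton_mul.mp hp
    obtain ⟨j₂, h₂, rfl⟩ := Ideal.mem_span_singleton_mul.mp hq
    exact ⟨j₁, h₁, j₂, h₂, h.symm⟩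
  obtain ⟨j₁, h₁, j₂, h₂, h⟩ := h1
  have h3 : x ∣ y * j₂ := ⟨g - j₁, by linear_combination -h⟩
  obtain ⟨q, rfl⟩ := (hxp.dvd_or_dvd h3).resolve_left (not_dvd_y hM hd)
  have : g = j₁ + y * q := by
    apply mul_left_cancel₀ hxp.ne_zero
    rw [h]; ring
  rw [this]
  exact J.add_mem h₁ (hJ.2 _ h₂)

lemma Ctr.colon_M_pow (hM : maximalIdeal R = Ideal.span {x, y}) (hd : NoPrin R) {s : ℕ}
    (hJ : Ctr x y J s) (n : ℕ) {g : R} (hg : x ^ n * g ∈ maximalIdeal R ^ n * J) : g ∈ J := by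
  induction n with
  | zero => simpa using hg
  | succ n ih =>
    apply ih
    apply ((Ctr.max_pow hM hd n).mul hM hd hJ).colon_M hM hd
    rw [← mul_assoc, ← pow_succ', ← mul_assoc, ← pow_succ']; exact hg

lemma descent (hM : maximalIdeal R = Ideal.span {x, y}) (L : ℕ → Ideal R) (r : ℕ)
    (hL : ∀ n, L n ≤ maximalIdeal R ^ n) (hx : ∀ n g, x * g ∈ L (n + 1) → g ∈ L n)
    (hm : ∀ n, maximalIdeal R * L n ≤ L (n + 1)) {a u b : R} (ha : a ∈ L r) (hu : IsUnit u)
    (hab : a = u * y ^ r + x * b) (j : ℕ) : L (r + j) ≤ maximalIdeal R ^ j * L r := by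
  have hmj : ∀ j, maximalIdeal R ^ j * L r ≤ L (r + j) := by
    intro j
    induction j with
    | zero => simp
    | succ j ih =>
      rw [pow_succ', mul_assoc]
      exact (Ideal.mul_mono_right ih).trans (hm _)
  induction j with
  | zero => simp
  | succ j ih =>
    intro f hf
    obtain ⟨c, m, hm', h⟩ := pow_split hM (r + j) (hL _ hf)
    obtain ⟨v, hv⟩ := hu.exists_left_inv
    have h1 : y ^ (j + 1) * a ∈ maximalIdeal R ^ (j + 1) * L r :=
      Ideal.mul_mem_mul (Ideal.pow_mem_pow (par_y hM) _) ha
    have e : x * (m - c * v * y ^ (j + 1) * b) = f - c * v * (y ^ (j + 1) * a) := by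
      rw [h, hab]
      linear_combination (c * y ^ (r + j + 1)) * hv
    have h2 : m - c * v * y ^ (j + 1) * b ∈ L (r + j) := by
      apply hx
      rw [e]
      exact Ideal.sub_mem _ hf (Ideal.mul_mem_left _ _ (hmj _ h1))
    have h3 : f = x * (m - c * v * y ^ (j + 1) * b) + c * v * (y ^ (j + 1) * a) := by
      rw [e]; ring
    rw [h3]
    refine Ideal.add_mem _ ?_ (Ideal.mul_mem_left _ _ h1)
    rw [pow_succ', mul_assoc]
    exact Ideal.mul_mem_mul (par_x hM) (ih h2)

end ctr
end DegOne

namespace DegOne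
universe u

section preqt
variable {R : Type u} [CommRing R] [IsLocalRing R]

/-- The quadratic transform along `w`, first properties. -/
structure PreQT (w : DiscreteValuationOn R) (e : ℕ) (R' : Type u) [CommRing R'] [Algebra R R']
    (w' : DiscreteValuationOn R') : Prop where
  inj : Function.Injective (algebraMap R R')
  val : ∀ z, w'.v (algebraMap R R' z) = w.v z
  frac : ∀ z : R', ∃ i : ℕ, ∃ p ∈ maximalIdeal R ^ i, ∃ q ∈ maximalIdeal R ^ i,
    w.v q = (i * e : ℕ) ∧ algebraMap R R' q * z = algebraMap R R' p
  ex : ∀ i : ℕ, ∀ p ∈ maximalIdeal R ^ i, ∀ q ∈ maximalIdeal R ^ i, w.v q = (i * e : ℕ) →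
    ∃ z, algebraMap R R' q * z = algebraMap R R' p

def qtSub (w : DiscreteValuationOn R) (e : ℕ) : Subring (FractionRing R) where
  carrier := {z | ∃ i : ℕ, ∃ p ∈ maximalIdeal R ^ i, ∃ q ∈ maximalIdeal R ^ i,
    w.v q = (i * e : ℕ) ∧ algebraMap R (FractionRing R) q * z = algebraMap R (FractionRing R) p}
  mul_mem' := by
    rintro z z' ⟨i, p, hp, q, hq, hw, h⟩ ⟨i', p', hp', q', hq', hw', h'⟩
    refine ⟨i + i', p * p', ?_, q * q', ?_, ?_, ?_⟩
    · rw [pow_add]; exact Ideal.mul_mem_mul hp hp'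
    · rw [pow_add]; exact Ideal.mul_mem_mul hq hq'
    · rw [w.v_mul, hw, hw', ← Nat.cast_add, add_mul]
    · rw [map_mul, map_mul, ← h, ← h']; ring
  one_mem' := ⟨0, 1, by simp, 1, by simp, by simpa using w.v_one, by simp⟩
  zero_mem' := ⟨0, 0, by simp, 1, by simp, by simpa using w.v_one, by simp⟩
  add_mem' := by
    rintro z z' ⟨i, p, hp, q, hq, hw, h⟩ ⟨i', p', hp', q', hq', hw', h'⟩
    refine ⟨i + i', p * q' + q * p', ?_, q * q', ?_, ?_, ?_⟩
    · rw [pow_add]; exact Ideal.add_mem _ (Ideal.mul_mem_mul hp hq') (Ideal.mul_mem_mul hq hp')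
    · rw [pow_add]; exact Ideal.mul_mem_mul hq hq'
    · rw [w.v_mul, hw, hw', ← Nat.cast_add, add_mul]
    · rw [map_mul, map_add, map_mul, map_mul, ← h, ← h']; ring
  neg_mem' := by
    rintro z ⟨i, p, hp, q, hq, hw, h⟩
    exact ⟨i, -p, Ideal.neg_mem_iff _ |>.mpr hp, q, hq, hw, by rw [map_neg, ← h]; ring⟩

lemma exists_preQT (w : DiscreteValuationOn R) {e : ℕ}
    (hmin : ∀ m ∈ maximalIdeal R, (e : ℕ∞) ≤ w.v m) :
    ∃ (R' : Type u) (_ : CommRing R') (_ : Algebra R R') (w' : DiscreteValuationOn R'),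
      PreQT w e R' w' := by
  classical
  haveI := isDomain_of_val w
  let S := qtSub w e
  have hS : ∀ r : R, algebraMap R (FractionRing R) r ∈ S := fun r =>
    ⟨0, r, by simp, 1, by simp, by simpa using w.v_one, by simp⟩
  let φ : R →+* S := (algebraMap R (FractionRing R)).codRestrict S hS
  letI : Algebra R S := φ.toAlgebra
  have hφ : ∀ r, ((algebraMap R S r : S) : FractionRing R) = algebraMap R (FractionRing R) r := fun r => rfl
  have hinjK : Function.Injective (algebraMap R (FractionRing R)) := IsFractionRing.injective R (FractionRing R)
  have hinj : Function.Injective (algebraMap R S) := fun a b h => by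
    apply hinjK
    rw [← hφ, ← hφ, h]
  have frac : ∀ z : S, ∃ i : ℕ, ∃ p ∈ maximalIdeal R ^ i, ∃ q ∈ maximalIdeal R ^ i,
    w.v q = (i * e : ℕ) ∧ algebraMap R S q * z = algebraMap R S p := by
    rintro ⟨z, i, p, hp, q, hq, hw, h⟩
    exact ⟨i, p, hp, q, hq, hw, Subtype.ext h⟩
  have hpow : ∀ i : ℕ, ∀ p ∈ maximalIdeal R ^ i, ((i * e : ℕ) : ℕ∞) ≤ w.v p := fun i p hp =>
    pow_le_V w (a := e) (fun m hm => hmin m hm) i hp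
  choose i p hp q hq hw h using frac
  have hwd : ∀ (z : S) (a b : R) (n : ℕ), w.v b = n → (n : ℕ∞) ≤ w.v a →
      algebraMap R S b * z = algebraMap R S a → (w.v (p z) - w.v (q z)) + n = w.v a := by
    intro z a b n hb hn hz
    have h1 : p z * b = a * q z := by
      apply hinj
      rw [map_mul, map_mul, ← hz, ← h]; ring
    have h2 := congrArg w.v h1
    rw [w.v_mul, w.v_mul, hb, hw] at h2
    have h3 : w.v (p z) - w.v (q z) + w.v (q z) = w.v (p z) :=
      tsub_add_cancel_of_le (by rw [hw]; exact hpow _ _ (hp z))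
    rw [hw] at h3 ⊢
    rw [← h3] at h2
    have h4 : (w.v (p z) - ((i z * e : ℕ) : ℕ∞) + n) + ((i z * e : ℕ) : ℕ∞) = w.v a + ((i z * e : ℕ) : ℕ∞) := by
      rw [← h2]; ring
    exact WithTop.add_right_cancel (ENat.coe_ne_top _) h4
  let W : S → ℕ∞ := fun z => w.v (p z) - w.v (q z)
  have hW : ∀ z, W z + (i z * e : ℕ) = w.v (p z) := fun z =>
    hwd z (p z) (q z) _ (hw z) (hpow _ _ (hp z)) (h z)
  have hval : ∀ r : R, W (algebraMap R S r) = w.v r := by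
    intro r
    have := hwd (algebraMap R S r) r 1 0 (by simpa using w.v_one) (by simp) (by simp)
    simpa using this
  have canc : ∀ {a b : ℕ∞} (n : ℕ), a + n = b + n → a = b := fun n h =>
    WithTop.add_right_cancel (ENat.coe_ne_top n) h
  let w' : DiscreteValuationOn S :=
    { v := W
      v_zero := by have := hval 0; rwa [map_zero, w.v_zero] at this
      v_one := by have := hval 1; rwa [map_one, w.v_one] at this
      v_mul := by
        intro a b
        have : W (a * b) + ((i a * e + i b * e : ℕ) : ℕ∞) = _ := hwd (a * b) (p a * p b) (q a * q b) (i a * e + i b * e)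
          (by rw [w.v_mul, hw, hw]; push_cast; rfl)
          (by rw [w.v_mul]; push_cast
              exact add_le_add (by exact_mod_cast hpow _ _ (hp a)) (by exact_mod_cast hpow _ _ (hp b)))
          (by rw [map_mul, map_mul, ← h, ← h]; ring)
        rw [w.v_mul, ← hW, ← hW] at this
        apply canc (i a * e + i b * e)
        refine Eq.trans this ?_
        push_cast; ring
      v_add := by
        intro a b
        have hm : p a * q b + q a * p b ∈ maximalIdeal R ^ (i a + i b) := by
          rw [pow_add]
          exact Ideal.add_mem _ (Ideal.mul_mem_mul (hp a) (hq b)) (Ideal.mul_mem_mul (hq a) (hp b))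
        have : W (a + b) + ((i a * e + i b * e : ℕ) : ℕ∞) = _ := hwd (a + b) (p a * q b + q a * p b) (q a * q b) (i a * e + i b * e)
          (by rw [w.v_mul, hw, hw]; push_cast; rfl)
          (by have := hpow _ _ hm; rwa [add_mul] at this)
          (by rw [map_mul, map_add, map_mul, map_mul, ← h, ← h]; ring)
        have h2 := w.v_add (p a * q b) (q a * p b)
        rw [← this, w.v_mul, w.v_mul, ← hW, ← hW, hw, hw] at h2
        have h3 : min (W a) (W b) + ((i a * e + i b * e : ℕ) : ℕ∞) ≤
            W (a + b) + ((i a * e + i b * e : ℕ) : ℕ∞) := by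
          refine le_trans (le_min ?_ ?_) h2
          · have := min_le_left (W a) (W b)
            calc _ ≤ W a + ((i a * e + i b * e : ℕ) : ℕ∞) := by gcongr
              _ = _ := by push_cast; ring
          · have := min_le_right (W a) (W b)
            calc _ ≤ W b + ((i a * e + i b * e : ℕ) : ℕ∞) := by gcongr
              _ = _ := by push_cast; ring
        exact (ENat.add_le_add_iff_right (ENat.coe_ne_top _)).mp h3
      v_top_iff := by
        intro z
        constructor
        · intro hz
          have h1 := hW z
          rw [hz, top_add] at h1
          have h2 := (w.v_top_iff _).mp h1.symm
          have h3 := h z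
          rw [h2, map_zero] at h3
          rcases mul_eq_zero.mp h3 with h4 | h4
          · exfalso
            have h5 : q z = 0 := hinj (by rw [h4, map_zero])
            have := hw z
            rw [h5, w.v_zero] at this
            exact ENat.coe_ne_top _ this.symm
          · exact h4
        · rintro rfl
          have := hval 0; rwa [map_zero, w.v_zero] at this
      v_nontrivial := by
        obtain ⟨x, hx⟩ := w.v_nontrivial
        exact ⟨algebraMap R S x, by rw [hval]; exact hx⟩ }
  refine ⟨S, inferInstance, inferInstance, w', ⟨hinj, hval, fun z => ⟨i z, p z, hp z, q z, hq z, hw z, h z⟩, ?_⟩⟩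
  intro n a ha b hb hwb
  have hb0 : algebraMap R (FractionRing R) b ≠ 0 := by
    intro h0
    have : b = 0 := hinjK (by rw [h0, map_zero])
    rw [this, w.v_zero] at hwb
    exact ENat.coe_ne_top _ hwb.symm
  refine ⟨⟨algebraMap R (FractionRing R) a / algebraMap R (FractionRing R) b, n, a, ha, b, hb, hwb, ?_⟩, Subtype.ext ?_⟩
  · rw [mul_div_assoc']; exact mul_div_cancel_left₀ _ hb0
  · show algebraMap R (FractionRing R) b * (algebraMap R (FractionRing R) a / algebraMap R (FractionRing R) b) = algebraMap R (FractionRing R) a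
    rw [mul_div_assoc']; exact mul_div_cancel_left₀ _ hb0

end preqt
end DegOne

namespace DegOne
universe u

section qt
variable {R : Type u} [CommRing R] [IsLocalRing R]

/-- Standing assumptions for a quadratic transform. -/
structure Ctx (w : DiscreteValuationOn R) (x y : R) (e : ℕ) : Prop where
  hpos : ∀ z ∈ maximalIdeal R, w.v z ≠ 0
  hM : maximalIdeal R = Ideal.span {x, y}
  hd : NoPrin R
  hx : w.v x = e
  hmin : ∀ m ∈ maximalIdeal R, (e : ℕ∞) ≤ w.v m
  hy : (e : ℕ∞) < w.v y

/-- The quadratic transform with all its properties. -/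
structure QT (w : DiscreteValuationOn R) (x y : R) (e : ℕ) (R' : Type u) [CommRing R']
    [IsLocalRing R'] [Algebra R R'] (w' : DiscreteValuationOn R') (t : R') : Prop extends
    PreQT w e R' w' where
  yt : algebraMap R R' y = algebraMap R R' x * t
  hM' : maximalIdeal R' = Ideal.span {algebraMap R R' x, t}
  res : ∀ z : R', ∃ c : R, z - algebraMap R R' c ∈ maximalIdeal R'
  pos : ∀ z ∈ maximalIdeal R', w'.v z ≠ 0
  noprin : NoPrin R'
  noeth : IsNoetherianRing R'
  algc : IsAlgClosed (ResidueField R')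

variable {w : DiscreteValuationOn R} {x y : R} {e : ℕ}

lemma Ctx.e_pos (C : Ctx w x y e) : 0 < e := by
  have := C.hpos x (par_x C.hM)
  rw [C.hx] at this
  have : e ≠ 0 := by exact_mod_cast this
  omega

lemma Ctx.pow_le (C : Ctx w x y e) {i : ℕ} {p : R} (hp : p ∈ maximalIdeal R ^ i) :
    ((i * e : ℕ) : ℕ∞) ≤ w.v p :=
  pow_le_V w (a := e) (fun m hm => C.hmin m hm) i hp

lemma Ctx.notMem (C : Ctx w x y e) {i : ℕ} {q : R} (hw : w.v q = (i * e : ℕ)) :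
    q ∉ maximalIdeal R ^ (i + 1) := by
  intro h
  have := C.pow_le h
  rw [hw] at this
  have h2 : (i + 1) * e ≤ i * e := by exact_mod_cast this
  have := C.e_pos
  nlinarith

variable {R' : Type u} [CommRing R'] [Algebra R R'] {w' : DiscreteValuationOn R'}

lemma PreQT.val_rep (Q : PreQT w e R' w') {q p : R} {z : R'}
    (h : algebraMap R R' q * z = algebraMap R R' p) : w.v q + w'.v z = w.v p := by
  rw [← Q.val p, ← h, w'.v_mul, Q.val]

lemma PreQT.ne_zero (Q : PreQT w e R' w') {q : R} {n : ℕ} (h : w.v q = n) : algebraMap R R' q ≠ 0 := by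
  intro h0
  have : q = 0 := Q.inj (by rw [h0, map_zero])
  rw [this, w.v_zero] at h
  exact ENat.coe_ne_top _ h.symm

lemma PreQT.isUnit (Q : PreQT w e R' w') {z : R'} (hz : w'.v z = 0) : IsUnit z := by
  haveI := isDomain_of_val w'
  obtain ⟨i, p, hp, q, hq, hw, h⟩ := Q.frac z
  have h1 := Q.val_rep h
  rw [hz, add_zero, hw] at h1
  obtain ⟨z', h'⟩ := Q.ex i q hq p hp h1.symm
  refine IsUnit.of_mul_eq_one z' ?_
  apply mul_left_cancel₀ (Q.ne_zero hw)
  rw [← mul_assoc, h, h', mul_one]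

lemma PreQT.isUnit_iff (Q : PreQT w e R' w') {z : R'} : IsUnit z ↔ w'.v z = 0 :=
  ⟨fun h => v_unit w' h, Q.isUnit⟩

lemma PreQT.isLocalRing (Q : PreQT w e R' w') : IsLocalRing R' := by
  haveI := isDomain_of_val w'
  apply IsLocalRing.of_nonunits_add
  intro a b ha hb
  rw [mem_nonunits_iff, Q.isUnit_iff] at *
  intro h
  have := w'.v_add a b
  rw [h] at this
  rcases min_choice (w'.v a) (w'.v b) with h1 | h1
  · rw [h1] at this; exact ha (le_antisymm this bot_le)
  · rw [h1] at this; exact hb (le_antisymm this bot_le)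

open Polynomial in
lemma form_t (hM : maximalIdeal R = Ideal.span {x, y}) {t : R'}
    (ht : algebraMap R R' y = algebraMap R R' x * t) {i : ℕ} {f : R} (hf : f ∈ maximalIdeal R ^ i) :
    ∃ P : R[X], P.natDegree ≤ i ∧ algebraMap R R' f = algebraMap R R' x ^ i * aeval t P := by
  obtain ⟨P, hP, hd⟩ := form hM i hf
  refine ⟨P, hd, ?_⟩
  rw [hP, map_sum, aeval_eq_sum_range' (Nat.lt_succ_of_le hd), Finset.mul_sum]
  apply Finset.sum_congr rfl
  intro j hj
  have hj' : j ≤ i := by simpa [Nat.lt_succ_iff] using hj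
  rw [map_mul, map_mul, map_pow, map_pow, ht, mul_pow, Algebra.smul_def]
  have : algebraMap R R' x ^ i = algebraMap R R' x ^ j * algebraMap R R' x ^ (i - j) := by
    rw [← pow_add]; congr 1; omega
  rw [this]; ring

open Polynomial in
lemma aeval_sub_coeff (t : R') (P : R[X]) : t ∣ aeval t P - algebraMap R R' (P.coeff 0) := by
  refine ⟨aeval t P.divX, ?_⟩
  have h := congrArg (aeval t) P.divX_mul_X_add
  rw [map_add, map_mul, aeval_X, aeval_C] at h
  rw [← h]; ring

lemma exists_QT [IsNoetherianRing R] [IsAlgClosed (ResidueField R)] (C : Ctx w x y e) :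
    ∃ (R' : Type u) (_ : CommRing R') (_ : IsLocalRing R') (_ : Algebra R R')
      (w' : DiscreteValuationOn R') (t : R'), QT w x y e R' w' t := by
  obtain ⟨R', _, _, w', Q⟩ := exists_preQT w C.hmin
  haveI := isDomain_of_val w'
  haveI hloc := Q.isLocalRing
  set α := algebraMap R R' with hα
  obtain ⟨t, ht⟩ := Q.ex 1 y (by simpa using par_y C.hM) x (by simpa using par_x C.hM)
    (by simpa using C.hx)
  have hx0 : α x ≠ 0 := Q.ne_zero C.hx
  have hmem : ∀ z : R', z ∈ maximalIdeal R' ↔ w'.v z ≠ 0 := by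
    intro z; rw [mem_maximalIdeal, mem_nonunits_iff, Q.isUnit_iff]
  have hwt : w'.v t ≠ 0 := by
    intro h
    have := Q.val_rep ht
    rw [h, add_zero, C.hx] at this
    exact absurd C.hy (by rw [this]; exact lt_irrefl _)
  have htM : t ∈ maximalIdeal R' := (hmem t).mpr hwt
  have hRM : ∀ r : R, r ∈ maximalIdeal R → α r ∈ maximalIdeal R' := fun r hr => by
    rw [hmem, Q.val]; exact C.hpos r hr
  have hRu : ∀ r : R, r ∉ maximalIdeal R → IsUnit r := fun r hr => by
    simpa using hr
  -- fractions in terms of polynomials in `t`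
  have frac' : ∀ z : R', ∃ P S : Polynomial R, Polynomial.aeval t S * z = Polynomial.aeval t P ∧
      IsUnit (Polynomial.aeval t S) := by
    intro z
    obtain ⟨i, p, hp, q, hq, hw, h⟩ := Q.frac z
    obtain ⟨P, -, hP⟩ := form_t C.hM ht.symm hp
    obtain ⟨S, -, hS⟩ := form_t C.hM ht.symm hq
    refine ⟨P, S, ?_, ?_⟩
    · rw [hP, hS, mul_assoc] at h
      exact mul_left_cancel₀ (pow_ne_zero _ hx0) h
    · apply Q.isUnit
      have := Q.val q
      rw [hS, w'.v_mul, v_pow, Q.val, hw, C.hx] at this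
      have h2 : ((i * e : ℕ) : ℕ∞) + w'.v (Polynomial.aeval t S) = ((i * e : ℕ) : ℕ∞) + 0 := by
        rw [add_zero]; push_cast; rw [this]; push_cast; rfl
      exact WithTop.add_left_cancel (ENat.coe_ne_top _) h2
  have hc0 : ∀ P : Polynomial R, Polynomial.aeval t P ∈ maximalIdeal R' → P.coeff 0 ∈ maximalIdeal R := by
    intro P hP
    by_contra hn
    have h1 := (hRu _ hn).map α
    obtain ⟨b, hb⟩ := aeval_sub_coeff (R' := R') t P
    have : α (P.coeff 0) ∈ maximalIdeal R' := by
      have e1 : α (P.coeff 0) = Polynomial.aeval t P - t * b := by rw [← hb]; ring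
      rw [e1]; exact Ideal.sub_mem _ hP (Ideal.mul_mem_right _ _ htM)
    exact (mem_maximalIdeal _).mp this h1
  have hxM' : ∀ r ∈ maximalIdeal R, α r ∈ Ideal.span {α x, t} := by
    intro r hr
    rw [C.hM, Ideal.mem_span_pair] at hr
    obtain ⟨a, b, rfl⟩ := hr
    rw [Ideal.mem_span_pair]
    exact ⟨α a + α b * t, 0, by rw [map_add, map_mul, map_mul, ← ht]; ring⟩
  have hM' : maximalIdeal R' = Ideal.span {α x, t} := by
    apply le_antisymm
    · intro z hz
      obtain ⟨P, S, h, hS⟩ := frac' z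
      have h1 : P.coeff 0 ∈ maximalIdeal R := by
        apply hc0; rw [← h]; exact Ideal.mul_mem_left _ _ hz
      obtain ⟨b, hb⟩ := aeval_sub_coeff (R' := R') t P
      rw [← Ideal.unit_mul_mem_iff_mem _ hS, h]
      have e1 : Polynomial.aeval t P = α (P.coeff 0) + b * t := by rw [mul_comm b, ← hb]; ring
      rw [e1]
      exact Ideal.add_mem _ (hxM' _ h1) (Ideal.mul_mem_left _ _ (Ideal.subset_span (by simp)))
    · rw [Ideal.span_le]
      rintro z (rfl | rfl)
      · exact hRM _ (par_x C.hM)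
      · exact htM
  have res : ∀ z : R', ∃ c : R, z - α c ∈ maximalIdeal R' := by
    intro z
    obtain ⟨P, S, h, hS⟩ := frac' z
    have hS0 : IsUnit (S.coeff 0) := by
      apply hRu
      intro hn
      obtain ⟨b, hb⟩ := aeval_sub_coeff (R' := R') t S
      have e1 : Polynomial.aeval t S = α (S.coeff 0) + t * b := by rw [← hb]; ring
      have : Polynomial.aeval t S ∈ maximalIdeal R' := by
        rw [e1]; exact Ideal.add_mem _ (hRM _ hn) (Ideal.mul_mem_right _ _ htM)
      exact (mem_maximalIdeal _).mp this hS
    obtain ⟨v, hv⟩ := hS0.exists_left_inv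
    refine ⟨v * P.coeff 0, ?_⟩
    rw [← Ideal.unit_mul_mem_iff_mem _ (hS0.map α)]
    obtain ⟨b, hb⟩ := aeval_sub_coeff (R' := R') t S
    obtain ⟨b', hb'⟩ := aeval_sub_coeff (R' := R') t P
    have hv' : α v * α (S.coeff 0) = 1 := by rw [← map_mul, hv, map_one]
    have e1 : α (S.coeff 0) * (z - α (v * P.coeff 0)) = t * (b' - b * z) := by
      rw [map_mul]
      linear_combination (-α (P.coeff 0)) * hv' - z * hb + hb' + h
    rw [e1]; exact Ideal.mul_mem_right _ _ htM
  have noeth : IsNoetherianRing R' := by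
    rw [isNoetherianRing_iff_ideal_fg]
    intro J
    have h1 : J = Ideal.map (Polynomial.aeval t : Polynomial R →ₐ[R] R').toRingHom
        (Ideal.comap (Polynomial.aeval t : Polynomial R →ₐ[R] R').toRingHom J) := by
      apply le_antisymm
      · intro z hz
        obtain ⟨P, S, h, hS⟩ := frac' z
        rw [← Ideal.unit_mul_mem_iff_mem _ hS, h]
        apply Ideal.mem_map_of_mem
        rw [Ideal.mem_comap]
        show Polynomial.aeval t P ∈ J
        rw [← h]; exact Ideal.mul_mem_left _ _ hz
      · exact Ideal.map_comap_le
    rw [h1]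
    exact Ideal.FG.map (IsNoetherian.noetherian _) _
  have noprin : NoPrin R' := by
    intro z hz n hn
    have hxz : α x ^ n ∈ Ideal.span {z} := hn (Ideal.pow_mem_pow (hRM _ (par_x C.hM)) n)
    have htz : t ^ n ∈ Ideal.span {z} := hn (Ideal.pow_mem_pow htM n)
    obtain ⟨a, ha⟩ := Ideal.mem_span_singleton.mp hxz
    obtain ⟨b, hb⟩ := Ideal.mem_span_singleton.mp htz
    obtain ⟨i, p, hp, q, hq, hw, h⟩ := Q.frac z
    obtain ⟨j, p2, hp2, q2, hq2, hw2, h2⟩ := Q.frac a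
    obtain ⟨k, p3, hp3, q3, hq3, hw3, h3⟩ := Q.frac b
    have hpar : ∃ x y : R, maximalIdeal R = Ideal.span {x, y} := ⟨x, y, C.hM⟩
    have e1 : y ^ n * (q * q3) = x ^ n * (p * p3) := by
      apply Q.inj
      simp only [map_mul, map_pow]
      rw [← h, ← h3]
      rw [← ht, mul_pow, hb]; ring
    have hp' : p ∉ maximalIdeal R ^ (i + 1) := by
      intro hp1
      have m1 : x ^ n * (p * p3) ∈ maximalIdeal R ^ (n + (i + k) + 1) := by
        have : n + (i + k) + 1 = n + ((i + 1) + k) := by ring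
        rw [this, pow_add, pow_add]
        exact Ideal.mul_mem_mul (Ideal.pow_mem_pow (par_x C.hM) n) (Ideal.mul_mem_mul hp1 hp3)
      rw [← e1] at m1
      refine ord_mul hpar C.hd (Ideal.pow_mem_pow (par_y C.hM) n) ?_ (b := i + k) ?_ ?_ m1
      · have := unit_y_notMem C.hM C.hd (n := n) (b := 0) isUnit_one
        simpa using this
      · rw [pow_add]; exact Ideal.mul_mem_mul hq hq3
      · exact C.notMem (by rw [w.v_mul, hw, hw3]; push_cast; ring)
    have e2 : q * q2 * x ^ n = p * p2 := by
      apply Q.inj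
      simp only [map_mul, map_pow]
      rw [← h, ← h2]
      linear_combination (α q * α q2) * ha
    have hp2' : p2 ∈ maximalIdeal R ^ (n + j) := by
      apply mem_of_mul_mem w C.hpos hpar C.hd hp'
      rw [← e2]
      have : n + j + i = i + j + n := by ring
      rw [this, pow_add, pow_add]
      exact Ideal.mul_mem_mul (Ideal.mul_mem_mul hq hq2) (Ideal.pow_mem_pow (par_x C.hM) n)
    obtain ⟨a', ha'⟩ := Q.ex (n + j) p2 hp2' (x ^ n * q2)
      (by rw [pow_add]; exact Ideal.mul_mem_mul (Ideal.pow_mem_pow (par_x C.hM) n) hq2)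
      (by rw [w.v_mul, v_pow, C.hx, hw2]; push_cast; ring)
    have e3 : a = α x ^ n * a' := by
      apply mul_left_cancel₀ (Q.ne_zero hw2)
      rw [h2, ← ha', map_mul, map_pow]; ring
    have e4 : z * a' = 1 := by
      apply mul_left_cancel₀ (pow_ne_zero n hx0)
      rw [mul_one]
      conv_rhs => rw [ha, e3]
      ring
    exact (mem_maximalIdeal _).mp hz (IsUnit.of_mul_eq_one _ e4)
  have algc : IsAlgClosed (ResidueField R') := by
    haveI : IsLocalHom α := ⟨fun r hr => by
      by_contra hn
      exact (mem_maximalIdeal _).mp (hRM r ((mem_maximalIdeal _).mpr hn)) hr⟩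
    let ψ : ResidueField R →+* ResidueField R' := ResidueField.map α
    have hbij : Function.Bijective ψ := by
      refine ⟨ψ.injective, ?_⟩
      intro z
      obtain ⟨z, rfl⟩ := residue_surjective z
      obtain ⟨c, hc⟩ := res z
      refine ⟨residue R c, ?_⟩
      show ResidueField.map α (residue R c) = _
      rw [ResidueField.map_residue]
      symm
      rw [← sub_eq_zero, ← map_sub, residue_eq_zero_iff]
      exact hc
    exact IsAlgClosed.of_ringEquiv _ _ (RingEquiv.ofBijective ψ hbij)
  exact ⟨R', _, hloc, _, w', t,
    QT.mk Q ht.symm hM' res (fun z hz => (hmem z).mp hz) noprin noeth algc⟩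

end qt
end DegOne

namespace DegOne
universe u

section tr
variable {R : Type u} [CommRing R] [IsLocalRing R] [IsDomain R] [IsNoetherianRing R]
  [IsAlgClosed (ResidueField R)]
variable {w : DiscreteValuationOn R} {x y : R} {e : ℕ}
variable {R' : Type u} [CommRing R'] [IsLocalRing R'] [IsDomain R'] [Algebra R R']
  {w' : DiscreteValuationOn R'} {t : R'}

def Lf (x : R) (J' : Ideal R') (n : ℕ) : Ideal R :=
  Ideal.comap (algebraMap R R') (Ideal.span {algebraMap R R' x ^ n} * J')

lemma mem_Lf {J' : Ideal R'} {n : ℕ} {f : R} :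
    f ∈ Lf x J' n ↔ ∃ j ∈ J', algebraMap R R' f = algebraMap R R' x ^ n * j := by
  rw [Lf, Ideal.mem_comap, Ideal.mem_span_singleton_mul]
  constructor
  · rintro ⟨z, hz, h⟩; exact ⟨z, hz, h.symm⟩
  · rintro ⟨z, hz, h⟩; exact ⟨z, hz, h.symm⟩

lemma QT.x_ne (C : Ctx w x y e) (Q : QT w x y e R' w' t) : algebraMap R R' x ≠ 0 :=
  Q.ne_zero C.hx

lemma QT.mem_pow (C : Ctx w x y e) (Q : QT w x y e R' w' t) {n : ℕ} {f : R} {z : R'}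
    (h : algebraMap R R' f = algebraMap R R' x ^ n * z) : f ∈ maximalIdeal R ^ n := by
  obtain ⟨i, p, hp, q, hq, hw, hz⟩ := Q.frac z
  have e1 : q * f = x ^ n * p := by
    apply Q.inj
    rw [map_mul, map_mul, map_pow, h, ← hz]; ring
  apply mem_of_mul_mem w C.hpos ⟨x, y, C.hM⟩ C.hd (C.notMem hw)
  rw [e1, pow_add]
  exact Ideal.mul_mem_mul (Ideal.pow_mem_pow (par_x C.hM) n) hp

lemma QT.exists_div (C : Ctx w x y e) (Q : QT w x y e R' w' t) {n : ℕ} {f : R}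
    (h : f ∈ maximalIdeal R ^ n) : ∃ z, algebraMap R R' f = algebraMap R R' x ^ n * z := by
  obtain ⟨P, -, hP⟩ := form_t C.hM Q.yt h
  exact ⟨_, hP⟩

lemma Lf_le (C : Ctx w x y e) (Q : QT w x y e R' w' t) (J' : Ideal R') (n : ℕ) :
    Lf x J' n ≤ maximalIdeal R ^ n := fun f hf => by
  obtain ⟨j, _, h⟩ := mem_Lf.mp hf
  exact Q.mem_pow C h

lemma Lf_x (C : Ctx w x y e) (Q : QT w x y e R' w' t) (J' : Ideal R') (n : ℕ) (g : R)
    (hg : x * g ∈ Lf x J' (n + 1)) : g ∈ Lf x J' n := by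
  obtain ⟨j, hj, h⟩ := mem_Lf.mp hg
  refine mem_Lf.mpr ⟨j, hj, ?_⟩
  apply mul_left_cancel₀ (Q.x_ne C)
  rw [← map_mul, h]; ring

lemma Lf_max (C : Ctx w x y e) (Q : QT w x y e R' w' t) (J' : Ideal R') (n : ℕ) :
    maximalIdeal R * Lf x J' n ≤ Lf x J' (n + 1) := by
  rw [Ideal.mul_le]
  intro m hm f hf
  obtain ⟨j, hj, h⟩ := mem_Lf.mp hf
  obtain ⟨z, hz⟩ := Q.exists_div C (n := 1) (by simpa using hm)
  refine mem_Lf.mpr ⟨z * j, J'.mul_mem_left _ hj, ?_⟩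
  rw [map_mul, h, hz]; ring

lemma Lf_max_pow (C : Ctx w x y e) (Q : QT w x y e R' w' t) (J' : Ideal R') (n k : ℕ) :
    maximalIdeal R ^ k * Lf x J' n ≤ Lf x J' (n + k) := by
  induction k with
  | zero => simp
  | succ k ih =>
    rw [pow_succ', mul_assoc]
    exact (Ideal.mul_mono_right ih).trans (Lf_max C Q _ _)

lemma Lf_y (C : Ctx w x y e) (Q : QT w x y e R' w' t) (J' : Ideal R') (n : ℕ) (g : R)
    (hg : x * g ∈ Lf x J' n) : y * g ∈ Lf x J' n := by
  obtain ⟨j, hj, h⟩ := mem_Lf.mp hg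
  refine mem_Lf.mpr ⟨t * j, J'.mul_mem_left _ hj, ?_⟩
  rw [map_mul, Q.yt]
  rw [map_mul] at h
  linear_combination t * h

lemma Lf_mul_le (J' K' : Ideal R') (n k : ℕ) : Lf x J' n * Lf x K' k ≤ Lf x (J' * K') (n + k) := by
  rw [Ideal.mul_le]
  intro f hf g hg
  obtain ⟨j, hj, h⟩ := mem_Lf.mp hf
  obtain ⟨j', hj', h'⟩ := mem_Lf.mp hg
  refine mem_Lf.mpr ⟨j * j', Ideal.mul_mem_mul hj hj', ?_⟩
  rw [map_mul, h, h']; ring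

lemma QT.map_max (C : Ctx w x y e) (Q : QT w x y e R' w' t) {r : R} (hr : r ∈ maximalIdeal R) :
    ∃ b, algebraMap R R' r = algebraMap R R' x * b := by
  obtain ⟨z, hz⟩ := Q.exists_div C (n := 1) (by simpa using hr)
  exact ⟨z, by rw [hz, pow_one]⟩

lemma expand (C : Ctx w x y e) (Q : QT w x y e R' w' t) (s : ℕ) (z : R') :
    ∃ p : Polynomial R, p.degree < s ∧ ∃ u b,
      z = Polynomial.aeval t p + t ^ s * u + algebraMap R R' x * b := by
  induction s with
  | zero => exact ⟨0, by simp, z, 0, by simp⟩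
  | succ s ih =>
    obtain ⟨p, hp, u, b, h⟩ := ih
    obtain ⟨c, hc⟩ := Q.res u
    rw [Q.hM', Ideal.mem_span_pair] at hc
    obtain ⟨a1, a2, hc⟩ := hc
    refine ⟨p + Polynomial.C c * Polynomial.X ^ s, ?_, a2, b + t ^ s * a1, ?_⟩
    · refine lt_of_le_of_lt (Polynomial.degree_add_le _ _) (max_lt ?_ ?_)
      · exact hp.trans (by exact_mod_cast Nat.lt_succ_self s)
      · exact lt_of_le_of_lt (Polynomial.degree_C_mul_X_pow_le _ _) (by exact_mod_cast Nat.lt_succ_self s)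
    · rw [h]
      simp only [map_add, map_mul, Polynomial.aeval_C, map_pow, Polynomial.aeval_X]
      linear_combination (-t ^ s) * hc

lemma weier (C : Ctx w x y e) (Q : QT w x y e R' w' t) {s : ℕ} {f v h : R'} (hv : IsUnit v)
    (hf : f = v * t ^ s + algebraMap R R' x * h) (k : ℕ) (z : R') :
    ∃ p : Polynomial R, p.degree < s ∧ ∃ u b,
      z = Polynomial.aeval t p + f * u + algebraMap R R' x ^ k * b := by
  obtain ⟨v', hv'⟩ := hv.exists_left_inv
  induction k with
  | zero => exact ⟨0, by simp, 0, z, by simp⟩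
  | succ k ih =>
    obtain ⟨p, hp, u, b, e1⟩ := ih
    obtain ⟨p', hp', u', b', e2⟩ := expand C Q s b
    refine ⟨p + Polynomial.C (x ^ k) * p', ?_, u + algebraMap R R' x ^ k * v' * u', b' - v' * u' * h, ?_⟩
    · refine lt_of_le_of_lt (Polynomial.degree_add_le _ _) (max_lt hp ?_)
      rw [← Polynomial.smul_eq_C_mul]
      exact lt_of_le_of_lt (Polynomial.degree_smul_le _ _) hp'
    · rw [e1, e2, hf]
      simp only [map_add, map_mul, Polynomial.aeval_C, map_pow]
      linear_combination (-algebraMap R R' x ^ k * u' * t ^ s) * hv'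

lemma Lf_lead (C : Ctx w x y e) (Q : QT w x y e R' w' t) {J' : Ideal R'} {c s₀ s : ℕ}
    (hJ : maximalIdeal R' ^ c ≤ J') (hord : OrdAt (algebraMap R R' x) t J' s₀) (hs : s₀ ≤ s) :
    ∃ a ∈ Lf x J' s, ∃ u b, IsUnit u ∧ a = u * y ^ s + x * b := by
  obtain ⟨f₀, hf₀, v, h, hv, hf⟩ := hord.2
  have hf1 : t ^ (s - s₀) * f₀ = v * t ^ s + algebraMap R R' x * (t ^ (s - s₀) * h) := by
    have : t ^ s = t ^ (s - s₀) * t ^ s₀ := by rw [← pow_add]; congr 1; omega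
    rw [hf, this]; ring
  obtain ⟨p, hp, u, b, e1⟩ := weier C Q hv hf1 c (t ^ s)
  have h1 : t ^ s - Polynomial.aeval t p ∈ J' := by
    have : t ^ s - Polynomial.aeval t p = t ^ (s - s₀) * f₀ * u + algebraMap R R' x ^ c * b := by
      rw [sub_eq_iff_eq_add]
      exact e1.trans (by ring)
    rw [this]
    refine J'.add_mem (J'.mul_mem_right _ (J'.mul_mem_left _ hf₀)) (J'.mul_mem_right _ (hJ ?_))
    apply Ideal.pow_mem_pow
    rw [Q.hM']; exact Ideal.subset_span (by simp)
  have hpn : ∀ i, s ≤ i → p.coeff i = 0 := fun i hi =>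
    Polynomial.coeff_eq_zero_of_degree_lt (lt_of_lt_of_le hp (by exact_mod_cast hi))
  have h2 : Polynomial.aeval t p = ∑ i ∈ Finset.range s, algebraMap R R' (p.coeff i) * t ^ i := by
    by_cases hs0 : s = 0
    · subst hs0
      have : p = 0 := by ext i; simpa using hpn i (Nat.zero_le _)
      simp [this]
    · rw [Polynomial.aeval_eq_sum_range' (n := s)]
      · simp [Algebra.smul_def]
      · by_cases hp0 : p = 0
        · rw [hp0]; simp; omega
        · exact (Polynomial.natDegree_lt_iff_degree_lt hp0).mpr hp
  refine ⟨y ^ s - ∑ i ∈ Finset.range s, p.coeff i * y ^ i * x ^ (s - i), mem_Lf.mpr ⟨_, h1, ?_⟩, 1,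
    -∑ i ∈ Finset.range s, p.coeff i * y ^ i * x ^ (s - i - 1), isUnit_one, ?_⟩
  · rw [h2, map_sub, map_sum, mul_sub, Finset.mul_sum, map_pow, Q.yt, mul_pow]
    congr 1
    apply Finset.sum_congr rfl
    intro i hi
    have hi' : i < s := by simpa using hi
    rw [map_mul, map_mul, map_pow, map_pow, Q.yt, mul_pow]
    have : algebraMap R R' x ^ s = algebraMap R R' x ^ i * algebraMap R R' x ^ (s - i) := by
      rw [← pow_add]; congr 1; omega
    rw [this]; ring
  · rw [mul_neg, Finset.mul_sum, one_mul, sub_eq_add_neg]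
    congr 2
    apply Finset.sum_congr rfl
    intro i hi
    have hi' : i < s := by simpa using hi
    have : x ^ (s - i) = x * x ^ (s - i - 1) := by rw [← pow_succ']; congr 1; omega
    rw [this]; ring

lemma max_pow_le_ord (hM : maximalIdeal R = Ideal.span {x, y}) (s : ℕ) :
    maximalIdeal R ^ s ≤ Ideal.span {x} ⊔ Ideal.span {y ^ s} := by
  intro z hz
  rw [mem_sup_span]
  cases s with
  | zero => exact ⟨z, 0, by simp⟩
  | succ s =>
    obtain ⟨c, m, _, h⟩ := pow_split hM s hz
    exact ⟨c, m, h⟩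

lemma Lf_ctr (C : Ctx w x y e) (Q : QT w x y e R' w' t) {J' : Ideal R'} {c s₀ s : ℕ}
    (hJ : maximalIdeal R' ^ c ≤ J') (hord : OrdAt (algebraMap R R' x) t J' s₀) (hs : s₀ ≤ s) :
    Ctr x y (Lf x J' s) s :=
  ⟨⟨(Lf_le C Q _ _).trans (max_pow_le_ord C.hM s), Lf_lead C Q hJ hord hs⟩, Lf_y C Q _ _⟩

lemma Lf_add (C : Ctx w x y e) (Q : QT w x y e R' w' t) {J' : Ideal R'} {s : ℕ}
    (hl : ∃ a ∈ Lf x J' s, ∃ u b, IsUnit u ∧ a = u * y ^ s + x * b) (j : ℕ) :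
    Lf x J' (s + j) = maximalIdeal R ^ j * Lf x J' s := by
  obtain ⟨a, ha, u, b, hu, hab⟩ := hl
  exact le_antisymm (descent C.hM (Lf x J') s (Lf_le C Q _) (Lf_x C Q _) (Lf_max C Q _) ha hu hab j)
    (Lf_max_pow C Q _ _ _)

lemma QT.frac_Lf (C : Ctx w x y e) (Q : QT w x y e R' w' t) {J' : Ideal R'} {s : ℕ}
    (hl : ∃ a ∈ Lf x J' s, ∃ u b, IsUnit u ∧ a = u * y ^ s + x * b) {g : R'} (hg : g ∈ J') :
    ∃ i : ℕ, ∃ q ∈ maximalIdeal R ^ i, w.v q = (i * e : ℕ) ∧ ∃ F ∈ maximalIdeal R ^ i * Lf x J' s,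
      algebraMap R R' F = algebraMap R R' q * (algebraMap R R' x ^ s * g) := by
  obtain ⟨i, p, hp, q, hq, hw, h⟩ := Q.frac g
  refine ⟨i, q, hq, hw, x ^ s * p, ?_, ?_⟩
  · rw [← Lf_add C Q hl]
    obtain ⟨z, hz⟩ := Q.exists_div C hq
    refine mem_Lf.mpr ⟨z * g, J'.mul_mem_left _ hg, ?_⟩
    rw [map_mul, map_pow, ← h, hz]; ring
  · rw [map_mul, map_pow, ← h]; ring

lemma tr4 (C : Ctx w x y e) (Q : QT w x y e R' w' t) {J' K' : Ideal R'} {c s k : ℕ}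
    (hJ : maximalIdeal R' ^ c ≤ J') (hordJ : OrdAt (algebraMap R R' x) t J' s)
    (hK : maximalIdeal R' ^ c ≤ K') (hordK : OrdAt (algebraMap R R' x) t K' k) :
    Lf x (J' * K') (s + k) ≤ Lf x J' s * Lf x K' k := by
  have cJ := Lf_ctr C Q hJ hordJ le_rfl
  have cK := Lf_ctr C Q hK hordK le_rfl
  have lJ := Lf_lead C Q hJ hordJ le_rfl
  have lK := Lf_lead C Q hK hordK le_rfl
  have cJK := cJ.mul C.hM C.hd cK
  set J := Lf x J' s with hJd
  set K := Lf x K' k with hKd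
  have key : ∀ g ∈ J' * K', ∃ i : ℕ, ∃ q ∈ maximalIdeal R ^ i, w.v q = (i * e : ℕ) ∧
      ∃ F ∈ maximalIdeal R ^ i * (J * K),
      algebraMap R R' F = algebraMap R R' q * (algebraMap R R' x ^ (s + k) * g) := by
    intro g hg
    induction hg using Submodule.mul_induction_on' with
    | mem_mul_mem m hm n hn =>
      obtain ⟨i, q, hq, hw, F, hF, h⟩ := Q.frac_Lf C lJ hm
      obtain ⟨i', q', hq', hw', F', hF', h'⟩ := Q.frac_Lf C lK hn
      refine ⟨i + i', q * q', ?_, ?_, F * F', ?_, ?_⟩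
      · rw [pow_add]; exact Ideal.mul_mem_mul hq hq'
      · rw [w.v_mul, hw, hw']; push_cast; ring
      · have : maximalIdeal R ^ (i + i') * (J * K) =
          (maximalIdeal R ^ i * J) * (maximalIdeal R ^ i' * K) := by rw [pow_add]; ring
        rw [this]; exact Ideal.mul_mem_mul hF hF'
      · rw [map_mul, map_mul, h, h']; ring
    | add m _ n _ h1 h2 =>
      obtain ⟨i, q, hq, hw, F, hF, h⟩ := h1
      obtain ⟨i', q', hq', hw', F', hF', h'⟩ := h2
      refine ⟨i + i', q * q', ?_, ?_, q' * F + q * F', ?_, ?_⟩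
      · rw [pow_add]; exact Ideal.mul_mem_mul hq hq'
      · rw [w.v_mul, hw, hw']; push_cast; ring
      · refine Ideal.add_mem _ ?_ ?_
        · rw [pow_add, mul_comm (maximalIdeal R ^ i), mul_assoc]; exact Ideal.mul_mem_mul hq' hF
        · rw [pow_add, mul_assoc]; exact Ideal.mul_mem_mul hq hF'
      · rw [map_add, map_mul, map_mul, map_mul, h, h']; ring
  have ypow : ∀ (J' : Ideal R') (s : ℕ), maximalIdeal R' ^ c ≤ J' →
      (∃ a ∈ Lf x J' s, ∃ u b, IsUnit u ∧ a = u * y ^ s + x * b) →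
      Ideal.span {y ^ c} * maximalIdeal R ^ s ≤ maximalIdeal R ^ c * Lf x J' s := by
    intro J' s hJ hl
    rw [← Lf_add C Q hl, Ideal.span_singleton_mul_le_iff]
    intro h hh
    obtain ⟨z, hz⟩ := Q.exists_div C hh
    refine mem_Lf.mpr ⟨t ^ c * z, J'.mul_mem_right _ (hJ (Ideal.pow_mem_pow ?_ c)), ?_⟩
    · rw [Q.hM']; exact Ideal.subset_span (by simp)
    · rw [map_mul, map_pow, Q.yt, hz]; ring
  intro f hf
  have hfM : f ∈ maximalIdeal R ^ (s + k) := Lf_le C Q _ _ hf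
  obtain ⟨g, hg, hfg⟩ := mem_Lf.mp hf
  obtain ⟨i, q, hq, hw, F, hF, h⟩ := key g hg
  have hqf : q * f ∈ maximalIdeal R ^ i * (J * K) := by
    have : q * f = F := by apply Q.inj; rw [map_mul, hfg, h]
    rw [this]; exact hF
  have hy2 : y ^ (c + c) * f ∈ maximalIdeal R ^ (c + c) * (J * K) := by
    have h1 : Ideal.span {y ^ (c + c)} * maximalIdeal R ^ (s + k) ≤ maximalIdeal R ^ (c + c) * (J * K) := by
      calc _ = (Ideal.span {y ^ c} * maximalIdeal R ^ s) * (Ideal.span {y ^ c} * maximalIdeal R ^ k) := by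
            rw [pow_add, pow_add, ← Ideal.span_singleton_mul_span_singleton]; ring
        _ ≤ (maximalIdeal R ^ c * J) * (maximalIdeal R ^ c * K) :=
            Ideal.mul_mono (ypow J' s hJ lJ) (ypow K' k hK lK)
        _ = _ := by rw [pow_add]; ring
    exact h1 (Ideal.mul_mem_mul (Ideal.mem_span_singleton_self _) hfM)
  cases i with
  | zero =>
    have hqu : IsUnit q := by
      by_contra hn
      exact C.hpos q ((mem_maximalIdeal _).mpr hn) (by simpa using hw)
    rw [pow_zero, one_mul] at hqf
    exact (Ideal.unit_mul_mem_iff_mem _ hqu).mp hqf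
  | succ i =>
    obtain ⟨a, m, hm, hqe⟩ := pow_split (par_swap C.hM) i hq
    have hau : IsUnit a := by
      by_contra hn
      have h1 : ((((i + 1) * e : ℕ) : ℕ∞)) < w.v (a * x ^ (i + 1)) := by
        rw [w.v_mul, v_pow, C.hx]
        have h0 := C.hpos a ((mem_maximalIdeal _).mpr hn)
        have h01 : 1 ≤ w.v a := ENat.one_le_iff_ne_zero.mpr h0
        have h02 : ((((i + 1) * e : ℕ) : ℕ∞)) < 1 + ((((i + 1) * e : ℕ) : ℕ∞)) := by
          exact_mod_cast (by omega : (i + 1) * e < 1 + (i + 1) * e)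
        refine lt_of_lt_of_le h02 ?_
        push_cast
        gcongr
      have h2 : ((((i + 1) * e : ℕ) : ℕ∞)) < w.v (y * m) := by
        rw [w.v_mul]
        have h3 := C.pow_le hm
        have h4 := C.hy
        have h5 : ((((i + 1) * e : ℕ) : ℕ∞)) = (e : ℕ∞) + ((i * e : ℕ) : ℕ∞) := by push_cast; ring
        rw [h5]
        exact ENat.add_lt_add_of_lt_of_le (ENat.coe_ne_top _) h4 h3
      have h3 := w.v_add (a * x ^ (i + 1)) (y * m)
      rw [← hqe, hw] at h3
      exact absurd h3 (not_le.mpr (lt_min h1 h2))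
    set A := a * x ^ (i + 1) with hA
    set B := -(y * m) with hB
    have hAB : q = A - B := by rw [hqe]; ring
    set n := c + c with hn
    have hAM : A ∈ maximalIdeal R ^ (i + 1) :=
      Ideal.mul_mem_left _ _ (Ideal.pow_mem_pow (par_x C.hM) _)
    have hBM : B ∈ maximalIdeal R ^ (i + 1) := by
      rw [pow_succ']; exact (Ideal.neg_mem_iff _).mpr (Ideal.mul_mem_mul (par_y C.hM) hm)
    have hBf : B ^ n * f ∈ maximalIdeal R ^ ((i + 1) * n) * (J * K) := by
      have e1 : B ^ n * f = (-1) ^ n * (m ^ n * (y ^ n * f)) := by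
        rw [hB, neg_eq_neg_one_mul, mul_pow, mul_pow]; ring
      have e2 : maximalIdeal R ^ ((i + 1) * n) * (J * K) =
          (maximalIdeal R ^ i) ^ n * (maximalIdeal R ^ n * (J * K)) := by
        rw [add_mul, one_mul, pow_add, pow_mul]; ring
      rw [e1, e2]
      exact Ideal.mul_mem_left _ _ (Ideal.mul_mem_mul (Ideal.pow_mem_pow hm n) hy2)
    have hdiff : (A ^ n - B ^ n) * f ∈ maximalIdeal R ^ ((i + 1) * n) * (J * K) := by
      by_cases hn0 : n = 0
      · rw [hn0]; simp
      obtain ⟨n', hn'⟩ := Nat.exists_eq_succ_of_ne_zero hn0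
      rw [hn', ← Commute.geom_sum₂_mul (Commute.all A B), ← hAB, mul_assoc]
      have e2 : maximalIdeal R ^ ((i + 1) * n'.succ) * (J * K) =
          maximalIdeal R ^ ((i + 1) * n') * (maximalIdeal R ^ (i + 1) * (J * K)) := by
        rw [Nat.mul_succ, pow_add]; ring
      rw [e2]
      refine Ideal.mul_mem_mul (Ideal.sum_mem _ ?_) hqf
      intro j hj
      have hj' : j ≤ n' := by
        have := Finset.mem_range.mp hj; omega
      have e3 : (i + 1) * n' = (i + 1) * j + (i + 1) * (n'.succ - 1 - j) := by
        rw [← mul_add]; congr 1; simp; omega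
      rw [e3, pow_add, pow_mul, pow_mul]
      exact Ideal.mul_mem_mul (Ideal.pow_mem_pow hAM _) (Ideal.pow_mem_pow hBM _)
    have hAf : x ^ ((i + 1) * n) * f ∈ maximalIdeal R ^ ((i + 1) * n) * (J * K) := by
      have h1 : A ^ n * f ∈ maximalIdeal R ^ ((i + 1) * n) * (J * K) := by
        have : A ^ n * f = (A ^ n - B ^ n) * f + B ^ n * f := by ring
        rw [this]; exact Ideal.add_mem _ hdiff hBf
      have h2 : A ^ n * f = a ^ n * (x ^ ((i + 1) * n) * f) := by
        rw [hA, mul_pow, pow_mul]; ring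
      rw [h2] at h1
      exact (Ideal.unit_mul_mem_iff_mem _ (hau.pow n)).mp h1
    exact cJK.colon_M_pow C.hM C.hd _ hAf

end tr
end DegOne

namespace DegOne
universe u

section tr
variable {R : Type u} [CommRing R] [IsLocalRing R] [IsDomain R] [IsNoetherianRing R]
  [IsAlgClosed (ResidueField R)]
variable {w : DiscreteValuationOn R} {x y : R} {e N N' r : ℕ}

lemma ord_le_of_mem (hM : maximalIdeal R = Ideal.span {x, y}) (hd : NoPrin R) {s k : ℕ} {u b : R}
    (hu : IsUnit u) (h : u * y ^ s + x * b ∈ Ideal.span {x} ⊔ Ideal.span {y ^ k}) : k ≤ s := by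
  obtain ⟨c, b', hc⟩ := mem_sup_span.mp h
  by_contra! hst
  apply unit_y_notMem hM hd (n := s) (u := u) (b := b - b') hu
  have : u * y ^ s + x * (b - b') = c * y ^ k := by linear_combination hc
  rw [this]
  exact Ideal.mul_mem_left _ _ (Ideal.pow_le_pow_right hst (Ideal.pow_mem_pow (par_y hM) _))

lemma V_le_pow (hpos : ∀ z ∈ maximalIdeal R, w.v z ≠ 0)
    (hpar : ∃ x y : R, maximalIdeal R = Ideal.span {x, y}) (hd : NoPrin R)
    (hred : Red w N) (hle : V w N ≤ maximalIdeal R ^ r) (m : ℕ) :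
    V w (m * N) ≤ maximalIdeal R ^ (m * r) := by
  intro f hf
  by_cases hf0 : f = 0
  · rw [hf0]; exact Ideal.zero_mem _
  obtain ⟨s, hs, hs'⟩ := ord_exists w hpos hf0
  obtain ⟨x, y, hM, -, u, hu, g, hg⟩ := choose_par w hpar hs hs'
  obtain ⟨ρ, hρ⟩ := V_ord w hpos hM hd N
  have h1 : r ≤ ρ := by
    obtain ⟨a, ha, u', b, hu', hab⟩ := hρ.2
    apply ord_le_of_mem hM hd (b := b) hu'
    rw [← hab]
    exact max_pow_le_ord hM r (hle ha)
  have h2 := V_ord_mul w hpos hM hd hred hρ m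
  have h3 : m * ρ ≤ s := by
    apply ord_le_of_mem hM hd (b := g) hu
    rw [← hg]; exact h2.1 hf
  exact Ideal.pow_le_pow_right ((Nat.mul_le_mul_left m h1).trans h3) hs

/-- data of an ideal `V N` with order `r` -/
structure Dat (w : DiscreteValuationOn R) (x y : R) (e N N' r : ℕ) : Prop where
  hN : N = N' + r * e
  hle : V w N ≤ maximalIdeal R ^ r
  lead : ∃ a ∈ V w N, ∃ u b, IsUnit u ∧ a = u * y ^ r + x * b
  red : Red w N

variable {R' : Type u} [CommRing R'] [IsLocalRing R'] [IsDomain R'] [Algebra R R']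
  {w' : DiscreteValuationOn R'} {t : R'}

lemma QT.val_div (C : Ctx w x y e) (Q : QT w x y e R' w' t) {f : R} {z : R'} {n k : ℕ}
    (h : algebraMap R R' f = algebraMap R R' x ^ n * z) :
    ((k + n * e : ℕ) : ℕ∞) ≤ w.v f ↔ (k : ℕ∞) ≤ w'.v z := by
  rw [← Q.val f, h, w'.v_mul, v_pow, Q.val, C.hx]
  push_cast
  rw [add_comm, ENat.add_le_add_iff_left]
  exact_mod_cast ENat.coe_ne_top (n * e)

lemma V_eq_Lf (C : Ctx w x y e) (Q : QT w x y e R' w' t) (D : Dat w x y e N N' r) (m : ℕ) :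
    V w (m * N) = Lf x (V w' (m * N')) (m * r) := by
  have e1 : m * N = m * N' + m * r * e := by rw [D.hN]; ring
  ext f
  constructor
  · intro hf
    have hf' := V_le_pow C.hpos ⟨x, y, C.hM⟩ C.hd D.red D.hle m hf
    obtain ⟨z, hz⟩ := Q.exists_div C hf'
    refine mem_Lf.mpr ⟨z, ?_, hz⟩
    rw [mem_V] at hf ⊢
    rw [e1] at hf
    exact (Q.val_div C hz).mp hf
  · intro hf
    obtain ⟨z, hz, h⟩ := mem_Lf.mp hf
    rw [mem_V] at hz ⊢
    rw [e1]
    exact (Q.val_div C h).mpr hz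

lemma V_eq_Lf' (C : Ctx w x y e) (Q : QT w x y e R' w' t) (D : Dat w x y e N N' r) :
    V w N = Lf x (V w' N') r := by
  have := V_eq_Lf C Q D 1
  simpa using this

lemma Dat.lead_pow (D : Dat w x y e N N' r) (m : ℕ) :
    ∃ a ∈ V w (m * N), ∃ u b, IsUnit u ∧ a = u * y ^ (m * r) + x * b := by
  obtain ⟨a, ha, u, b, hu, hab⟩ := D.lead
  have h1 : x ∣ a ^ m - (u * y ^ r) ^ m := by
    refine dvd_trans ?_ (sub_dvd_pow_sub_pow a (u * y ^ r) m)
    exact ⟨b, by rw [hab]; ring⟩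
  obtain ⟨b', hb'⟩ := h1
  refine ⟨a ^ m, pow_le_V w le_rfl m (Ideal.pow_mem_pow ha m), u ^ m, b', hu.pow m, ?_⟩
  rw [mul_comm m r, pow_mul, ← mul_pow, ← hb']; ring

lemma map_V (C : Ctx w x y e) (Q : QT w x y e R' w' t) (D : Dat w x y e N N' r) (m : ℕ) :
    Ideal.map (algebraMap R R') (V w (m * N)) =
      Ideal.span {algebraMap R R' x ^ (m * r)} * V w' (m * N') := by
  apply le_antisymm
  · rw [Ideal.map_le_iff_le_comap, V_eq_Lf C Q D m]
    exact le_rfl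
  · rw [Ideal.span_singleton_mul_le_iff]
    intro z hz
    have hl := D.lead_pow m
    rw [V_eq_Lf C Q D m] at hl
    obtain ⟨i, q, hq, hw, F, hF, h⟩ := Q.frac_Lf C hl hz
    rw [← V_eq_Lf C Q D m] at hF
    obtain ⟨v, hv⟩ := Q.exists_div C hq
    have hvu : IsUnit v := by
      apply Q.isUnit
      have h1 := Q.val q
      rw [hv, w'.v_mul, v_pow, Q.val, hw, C.hx] at h1
      have h2 : ((i * e : ℕ) : ℕ∞) + w'.v v = ((i * e : ℕ) : ℕ∞) + 0 := by
        rw [add_zero]; push_cast; rw [h1]; push_cast; rfl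
      exact WithTop.add_left_cancel (ENat.coe_ne_top _) h2
    have hmap : Ideal.map (algebraMap R R') (maximalIdeal R ^ i * V w (m * N)) ≤
        Ideal.span {algebraMap R R' x ^ i} * Ideal.map (algebraMap R R') (V w (m * N)) := by
      rw [Ideal.map_mul]
      apply Ideal.mul_mono_left
      rw [Ideal.map_le_iff_le_comap]
      intro g hg
      obtain ⟨z, hz⟩ := Q.exists_div C hg
      rw [Ideal.mem_comap, Ideal.mem_span_singleton]
      exact ⟨z, hz⟩
    have h3 := hmap (Ideal.mem_map_of_mem _ hF)
    rw [h, hv] at h3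
    obtain ⟨g, hg, hge⟩ := Ideal.mem_span_singleton_mul.mp h3
    have h4 : v * (algebraMap R R' x ^ (m * r) * z) = g := by
      apply mul_left_cancel₀ (pow_ne_zero i (Q.x_ne C))
      rw [hge]; ring
    rw [← h4] at hg
    exact (Ideal.unit_mul_mem_iff_mem _ hvu).mp hg

lemma red' (C : Ctx w x y e) (Q : QT w x y e R' w' t) (D : Dat w x y e N N' r) : Red w' N' := by
  intro m
  obtain ⟨k, hk⟩ := D.red m
  refine ⟨k, ?_⟩
  have h1 := Ideal.map_mono (f := algebraMap R R') hk
  have hm1 := map_V C Q D 1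
  rw [one_mul, one_mul, one_mul] at hm1
  rw [Ideal.map_mul, Ideal.map_pow, Ideal.map_pow, Ideal.map_pow, map_V C Q D m, hm1,
    mul_pow, mul_pow, mul_pow, Ideal.span_singleton_pow, Ideal.span_singleton_pow,
    Ideal.span_singleton_pow] at h1
  have h2 : Ideal.span {(algebraMap R R' x ^ r) ^ m} * V w' N' ^ m *
      (Ideal.span {(algebraMap R R' x ^ (m * r)) ^ k} * V w' (m * N') ^ k) =
      Ideal.span {(algebraMap R R' x ^ (m * r)) ^ (k + 1)} * (V w' N' ^ m * V w' (m * N') ^ k) := by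
    have : Ideal.span {(algebraMap R R' x ^ (m * r)) ^ (k + 1)} =
        Ideal.span {(algebraMap R R' x ^ r) ^ m} * Ideal.span {(algebraMap R R' x ^ (m * r)) ^ k} := by
      rw [Ideal.span_singleton_mul_span_singleton]; congr 2; ring
    rw [this]; ring
  rw [h2] at h1
  exact (Ideal.span_singleton_mul_right_mono (pow_ne_zero _ (pow_ne_zero _ (Q.x_ne C)))).mp h1

lemma attained' (C : Ctx w x y e) (Q : QT w x y e R' w' t) (D : Dat w x y e N N' r)
    (h : ∃ f, w.v f = N) : ∃ f, w'.v f = N' := by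
  obtain ⟨f, hf⟩ := h
  have hfV : f ∈ V w N := by rw [mem_V, hf]
  obtain ⟨z, hz⟩ := Q.exists_div C (D.hle hfV)
  refine ⟨z, ?_⟩
  have h1 := Q.val f
  rw [hz, w'.v_mul, v_pow, Q.val, hf, C.hx, D.hN] at h1
  have h2 : ((r * e : ℕ) : ℕ∞) + w'.v z = ((r * e : ℕ) : ℕ∞) + N' := by
    push_cast; rw [h1]; push_cast; ring
  exact WithTop.add_left_cancel (ENat.coe_ne_top _) h2

lemma coeff_mem (C : Ctx w x y e) (Q : QT w x y e R' w' t) (hx : Prime (algebraMap R R' x))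
    (hxt : ¬ algebraMap R R' x ∣ t) (r : ℕ) (P : Polynomial R)
    (h : Polynomial.aeval t P ∈ Ideal.span {algebraMap R R' x} ⊔ Ideal.span {t ^ (r + 1)}) :
    P.coeff r ∈ maximalIdeal R := by
  have h0 : ∀ {P : Polynomial R} {s : ℕ}, Polynomial.aeval t P ∈ Ideal.span {algebraMap R R' x} ⊔
      Ideal.span {t ^ (s + 1)} → P.coeff 0 ∈ maximalIdeal R := by
    intro P s h
    obtain ⟨c, b, hc⟩ := mem_sup_span.mp h
    obtain ⟨b', hb'⟩ := aeval_sub_coeff (R' := R') t P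
    by_contra hn
    have hu : IsUnit (P.coeff 0) := by simpa using hn
    have hu' := hu.map (algebraMap R R')
    have : algebraMap R R' (P.coeff 0) ∈ maximalIdeal R' := by
      rw [Q.hM', Ideal.mem_span_pair]
      exact ⟨b, c * t ^ s - b', by linear_combination hb' - hc⟩
    exact (mem_maximalIdeal _).mp this hu'
  induction r generalizing P with
  | zero => exact h0 h
  | succ r ih =>
    have h1 : P.coeff (r + 1) = P.divX.coeff r := by simp [Polynomial.coeff_divX]
    rw [h1]
    apply ih
    obtain ⟨a, ha⟩ := Q.map_max C (h0 h)
    obtain ⟨c, b, hc⟩ := mem_sup_span.mp h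
    have h2 := congrArg (Polynomial.aeval t) P.divX_mul_X_add
    rw [map_add, map_mul, Polynomial.aeval_X, Polynomial.aeval_C, ha] at h2
    have h3 : algebraMap R R' x ∣ (Polynomial.aeval t P.divX - c * t ^ (r + 1)) * t :=
      ⟨b - a, by linear_combination h2 + hc⟩
    obtain ⟨d, hd⟩ := (hx.dvd_or_dvd h3).resolve_right hxt
    exact mem_sup_span.mpr ⟨c, d, by linear_combination hd⟩

lemma Lf_top (C : Ctx w x y e) (Q : QT w x y e R' w' t) {J' : Ideal R'} {n : ℕ}
    (h : Lf x J' n = ⊤) : n = 0 ∧ J' = ⊤ := by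
  have h1 : (1 : R) ∈ Lf x J' n := by rw [h]; trivial
  have hn : n = 0 := by
    by_contra hn
    have := Ideal.pow_le_self hn (Lf_le C Q _ _ h1)
    exact (mem_maximalIdeal _).mp this isUnit_one
  refine ⟨hn, ?_⟩
  subst hn
  obtain ⟨j, hj, hj1⟩ := mem_Lf.mp h1
  rw [map_one, pow_zero, one_mul] at hj1
  rw [Ideal.eq_top_iff_one, hj1]; exact hj

lemma V_ne_top (w : DiscreteValuationOn R') (hN' : 0 < N') : V w N' ≠ ⊤ := by
  intro h
  have : (1 : R') ∈ V w N' := by rw [h]; trivial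
  rw [mem_V, w.v_one] at this
  have : N' ≤ 0 := by exact_mod_cast this
  omega

lemma tr6 (C : Ctx w x y e) (Q : QT w x y e R' w' t) (D : Dat w x y e N N' r)
    (hs : (V w N).IsSimpleIdeal) (hN' : 0 < N') :
    OrdAt (algebraMap R R' x) t (V w' N') r := by
  haveI := Q.noeth
  have hxp := x_prime Q.hM' Q.noprin
  obtain ⟨l, hl⟩ := V_ord w' Q.pos Q.hM' Q.noprin N'
  have h1 : l ≤ r := by
    by_contra! hlt
    obtain ⟨a, ha, u, b, hu, hab⟩ := D.lead
    obtain ⟨P, hP, hPd⟩ := form C.hM r (D.hle ha)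
    obtain ⟨z, hzV, hz⟩ := mem_Lf.mp ((V_eq_Lf' C Q D) ▸ ha)
    have e1 : algebraMap R R' a = algebraMap R R' x ^ r * Polynomial.aeval t P := by
      rw [hP, map_sum, Polynomial.aeval_eq_sum_range' (Nat.lt_succ_of_le hPd), Finset.mul_sum]
      apply Finset.sum_congr rfl
      intro j hj
      have hj' : j ≤ r := by simpa [Nat.lt_succ_iff] using hj
      rw [map_mul, map_mul, map_pow, map_pow, Q.yt, mul_pow, Algebra.smul_def]
      have : algebraMap R R' x ^ r = algebraMap R R' x ^ j * algebraMap R R' x ^ (r - j) := by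
        rw [← pow_add]; congr 1; omega
      rw [this]; ring
    have e2 : z = Polynomial.aeval t P := by
      apply mul_left_cancel₀ (pow_ne_zero r (Q.x_ne C)); rw [← hz, e1]
    have h2 : Polynomial.aeval t P ∈ Ideal.span {algebraMap R R' x} ⊔ Ideal.span {t ^ (r + 1)} := by
      rw [← e2]
      refine (hl.1.trans (sup_le_sup_left ?_ _)) hzV
      rw [Ideal.span_singleton_le_span_singleton]
      exact pow_dvd_pow t hlt
    have h3 := coeff_mem C Q hxp (not_dvd_y Q.hM' Q.noprin) r P h2
    have h4 : x ∣ a - P.coeff r * y ^ r := by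
      rw [hP]; exact form_mod P
    obtain ⟨c, hc⟩ := h4
    apply unit_y_notMem C.hM C.hd (n := r) (u := u) (b := b - c) hu
    have : u * y ^ r + x * (b - c) = P.coeff r * y ^ r := by linear_combination hc - hab
    rw [this, pow_succ']
    exact Ideal.mul_mem_mul h3 (Ideal.pow_mem_pow (par_y C.hM) r)
  rcases h1.eq_or_lt with h | hlt
  · rwa [← h]
  · exfalso
    have hlead := Lf_lead C Q (max_pow_le_V w' Q.pos N') hl le_rfl
    have h5 := Lf_add C Q hlead (r - l)
    rw [show l + (r - l) = r by omega, ← V_eq_Lf' C Q D] at h5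
    rcases hs.2 _ _ h5 with h | h
    · have h6 := Ideal.pow_le_self (I := maximalIdeal R) (n := r - l) (by omega)
      rw [h, top_le_iff] at h6
      exact (maximalIdeal.isMaximal R).ne_top h6
    · exact V_ne_top w' hN' (Lf_top C Q h).2

lemma tr7 (C : Ctx w x y e) (Q : QT w x y e R' w' t) (D : Dat w x y e N N' r)
    (hs : (V w N).IsSimpleIdeal) (hN' : 0 < N') : (V w' N').IsSimpleIdeal := by
  haveI := Q.noeth
  refine ⟨V_ne_top w' hN', ?_⟩
  intro J' K' hJK
  have hc := max_pow_le_V w' Q.pos N'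
  have hJ : maximalIdeal R' ^ N' ≤ J' := hc.trans (hJK ▸ Ideal.mul_le_left)
  have hK : maximalIdeal R' ^ N' ≤ K' := hc.trans (hJK ▸ Ideal.mul_le_right)
  have hex : ∀ L : Ideal R', maximalIdeal R' ^ N' ≤ L → ∃ s, OrdAt (algebraMap R R' x) t L s :=
    fun L hL => OrdAt.exists Q.hM' ⟨t ^ N', hL (Ideal.pow_mem_pow (par_y Q.hM') N'),
      y_pow_notMem Q.hM' Q.noprin N'⟩
  obtain ⟨s, hsJ⟩ := hex J' hJ
  obtain ⟨k, hkK⟩ := hex K' hK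
  have h1 := tr6 C Q D hs hN'
  have h2 := hsJ.mul hkK
  rw [← hJK] at h2
  have h3 : r = s + k := h1.unique Q.hM' Q.noprin h2
  have h4 : V w N = Lf x J' s * Lf x K' k := by
    rw [V_eq_Lf' C Q D, hJK, h3]
    exact le_antisymm (tr4 C Q hJ hsJ hK hkK) (Lf_mul_le _ _ _ _)
  rcases hs.2 _ _ h4 with h | h
  · exact Or.inl (Lf_top C Q h).2
  · exact Or.inr (Lf_top C Q h).2

end tr
end DegOne

namespace DegOne
universe u

section caseB
variable {R : Type u} [CommRing R] [IsLocalRing R] [IsDomain R] [IsNoetherianRing R]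
  [IsAlgClosed (ResidueField R)]
variable {w : DiscreteValuationOn R} {x y : R} {e : ℕ}

lemma caseB_val (hpos : ∀ z ∈ maximalIdeal R, w.v z ≠ 0)
    (hM : maximalIdeal R = Ideal.span {x, y}) (hd : NoPrin R)
    (hx : w.v x = e) (hmin : ∀ m ∈ maximalIdeal R, (e : ℕ∞) ≤ w.v m)
    (hB : ∀ c, ¬ (e : ℕ∞) < w.v (y - c * x)) (s : ℕ) (f : R)
    (hf : f ∈ maximalIdeal R ^ s) (hf' : f ∉ maximalIdeal R ^ (s + 1)) :
    w.v f = (s * e : ℕ) := by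
  have hlow : ∀ (i : ℕ) (p : R), p ∈ maximalIdeal R ^ i → ((i * e : ℕ) : ℕ∞) ≤ w.v p :=
    fun i p hp => pow_le_V w (a := e) (fun m hm => hmin m hm) i hp
  have he : 0 < e := by
    have := hpos x (par_x hM)
    rw [hx] at this
    have : e ≠ 0 := by exact_mod_cast this
    omega
  have hlow' : ∀ (i : ℕ) (p : R), p ∈ maximalIdeal R ^ (i + 1) → ((i * e : ℕ) : ℕ∞) < w.v p := by
    intro i p hp
    refine lt_of_lt_of_le ?_ (hlow _ _ hp)
    have : i * e < (i + 1) * e := by nlinarith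
    exact_mod_cast this
  induction s generalizing f with
  | zero =>
    have : IsUnit f := by simpa using hf'
    rw [v_unit w this]; simp
  | succ s ih =>
    obtain ⟨P, hP, hdeg⟩ := form hM (s + 1) hf
    have hp0 := form_map_ne hM P (hP ▸ hf')
    by_cases hdg : (P.map (residue R)).degree = 0
    · have hu : IsUnit (P.coeff 0) := by
        by_contra h
        have h1 : P.coeff 0 ∈ maximalIdeal R := (mem_maximalIdeal _).mpr h
        have h2 : (P.map (residue R)).coeff 0 = 0 := by
          rw [Polynomial.coeff_map, residue_eq_zero_iff]; exact h1
        have h3 := Polynomial.eq_C_of_degree_eq_zero hdg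
        rw [h2] at h3
        exact hp0 (by rw [h3]; simp)
      have h1 : f = P.coeff 0 * x ^ (s + 1) +
          ∑ i ∈ Finset.range (s + 1), P.coeff (i + 1) * y ^ (i + 1) * x ^ (s + 1 - (i + 1)) := by
        conv_lhs => rw [hP, Finset.sum_range_succ']
        simp [add_comm]
      have h2 : ∑ i ∈ Finset.range (s + 1), P.coeff (i + 1) * y ^ (i + 1) * x ^ (s + 1 - (i + 1))
          ∈ maximalIdeal R ^ (s + 1 + 1) := by
        apply Ideal.sum_mem
        intro i hi
        rw [Finset.mem_range] at hi
        have h3 : P.coeff (i + 1) ∈ maximalIdeal R := by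
          rw [← residue_eq_zero_iff, ← Polynomial.coeff_map]
          apply Polynomial.coeff_eq_zero_of_degree_lt
          rw [hdg]; exact_mod_cast Nat.succ_pos i
        rw [mul_assoc, pow_succ', ]
        exact Ideal.mul_mem_mul h3 (mono_mem hM (by omega))
      have h4 : w.v (P.coeff 0 * x ^ (s + 1)) = ((s + 1) * e : ℕ) := by
        rw [w.v_mul, v_unit w hu, v_pow, hx, zero_add]; norm_cast
      rw [h1, v_add_eq w (by rw [h4]; exact hlow' _ _ h2), h4]
    · obtain ⟨β, hβ⟩ := IsAlgClosed.exists_root _ hdg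
      obtain ⟨b, rfl⟩ := residue_surjective β
      obtain ⟨g, hg⟩ := form_eval (x := x) (y := y) P hdeg b
      rw [← hP] at hg
      have hPb : P.eval b ∈ maximalIdeal R := by
        rw [← residue_eq_zero_iff]
        have := hβ
        rw [Polynomial.IsRoot.def, Polynomial.eval_map, Polynomial.eval₂_at_apply] at this
        exact this
      have hrest : P.eval b * x ^ (s + 1) ∈ maximalIdeal R ^ (s + 1 + 1) := by
        rw [pow_succ' (maximalIdeal R)]
        exact Ideal.mul_mem_mul hPb (Ideal.pow_mem_pow (par_x hM) _)
      have hMb := par_shift hM b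
      have hl2 : y - b * x ∉ maximalIdeal R ^ (1 + 1) := x_notMem_sq (par_swap hMb) hd
      have hprod : (y - b * x) * g ∈ maximalIdeal R ^ (s + 1) := by
        rw [← hg]
        exact Ideal.sub_mem _ hf (Ideal.pow_le_pow_right (Nat.le_succ _) hrest)
      have hgs : g ∈ maximalIdeal R ^ s := mem_of_mul_mem w hpos ⟨x, y, hM⟩ hd hl2 hprod
      have hgs' : g ∉ maximalIdeal R ^ (s + 1) := by
        intro h
        apply hf'
        have h5 : f = P.eval b * x ^ (s + 1) + (y - b * x) * g := by rw [← hg]; ring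
        rw [h5]
        refine Ideal.add_mem _ hrest ?_
        rw [pow_succ' (maximalIdeal R)]
        exact Ideal.mul_mem_mul (par_y hMb) h
      have hwl : w.v (y - b * x) = e := le_antisymm (not_lt.mp (hB b)) (hmin _ (par_y hMb))
      have h4 : w.v ((y - b * x) * g) = ((s + 1) * e : ℕ) := by
        rw [w.v_mul, hwl, ih g hgs hgs']; push_cast; ring
      have h5 : f = (y - b * x) * g + P.eval b * x ^ (s + 1) := by rw [← hg]; ring
      rw [h5, v_add_eq w (by rw [h4]; exact hlow' _ _ hrest), h4]

end caseB

lemma one_of_simple_pow {R : Type u} [CommRing R] [IsLocalRing R] {r : ℕ}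
    (h : (maximalIdeal R ^ r).IsSimpleIdeal) : r = 1 := by
  obtain ⟨h1, h2⟩ := h
  rcases r with _ | r
  · simp at h1
  · rcases h2 (maximalIdeal R) (maximalIdeal R ^ r) (pow_succ' _ _) with h | h
    · exact absurd h (maximalIdeal.isMaximal R).ne_top
    · rcases r with _ | r
      · rfl
      · exact absurd (top_le_iff.mp (h ▸ Ideal.pow_le_self (Nat.succ_ne_zero r)))
          (maximalIdeal.isMaximal R).ne_top

theorem main_induction (N : ℕ) : ∀ (R : Type u) [CommRing R] [IsLocalRing R] [IsNoetherianRing R]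
    [IsAlgClosed (ResidueField R)]
    (hpar : ∃ x y : R, maximalIdeal R = Ideal.span {x, y}) (hd : NoPrin R)
    (w : DiscreteValuationOn R) (hpos : ∀ z ∈ maximalIdeal R, w.v z ≠ 0) (hN : 0 < N)
    (hatt : ∃ f, w.v f = N) (hs : (V w N).IsSimpleIdeal) (hred : Red w N)
    (r : ℕ) (hle : V w N ≤ maximalIdeal R ^ r) (hnle : ¬ V w N ≤ maximalIdeal R ^ (r + 1))
    (e : ℕ) (he : ∃ x ∈ maximalIdeal R, w.v x = e)
    (hmin : ∀ m ∈ maximalIdeal R, (e : ℕ∞) ≤ w.v m), ∃ c : ℕ, e = c * r := by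
  induction N using Nat.strong_induction_on with
  | _ N IH =>
  intro R _ _ _ _ hpar hd w hpos hN hatt hs hred r hle hnle e he hmin
  haveI := isDomain_of_val w
  have hr0 : r ≠ 0 := by
    rintro rfl
    apply hnle
    rw [zero_add, pow_one]
    exact le_maximalIdeal (V_ne_top w hN)
  have hlow : ∀ (i : ℕ) (p : R), p ∈ maximalIdeal R ^ i → ((i * e : ℕ) : ℕ∞) ≤ w.v p :=
    fun i p hp => pow_le_V w (a := e) (fun m hm => hmin m hm) i hp
  have hend : N ≤ r * e → ∃ c : ℕ, e = c * r := by
    intro h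
    have h1 : V w N = maximalIdeal R ^ r := by
      apply le_antisymm hle
      intro p hp
      rw [mem_V]
      exact le_trans (by exact_mod_cast h) (hlow _ _ hp)
    rw [h1] at hs
    have := one_of_simple_pow hs
    exact ⟨e, by rw [this, mul_one]⟩
  obtain ⟨f, hfV, hf'⟩ := Set.not_subset.mp hnle
  have hfr := hle hfV
  obtain ⟨x, y, hM, hxm, u, hu, g, hg⟩ := choose_par w hpar hfr hf'
  have hx : w.v x = e := by
    apply le_antisymm
    · obtain ⟨x0, hx0, h0⟩ := he
      rw [← h0]; exact hxm _ hx0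
    · exact hmin _ (par_x hM)
  by_cases hA : ∃ c, (e : ℕ∞) < w.v (y - c * x)
  swap
  · push Not at hA
    have := caseB_val hpos hM hd hx hmin (fun c => not_lt.mpr (hA c)) r f hfr hf'
    apply hend
    have h2 : (N : ℕ∞) ≤ w.v f := hfV
    rw [this] at h2
    exact_mod_cast h2
  obtain ⟨c, hc⟩ := hA
  have hMc := par_shift hM c
  by_cases hNr : N ≤ r * e
  · exact hend hNr
  push Not at hNr
  obtain ⟨N', hN'⟩ : ∃ N', N = N' + r * e := ⟨N - r * e, by omega⟩
  have hN'0 : 0 < N' := by omega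
  have C : Ctx w x (y - c * x) e := ⟨hpos, hMc, hd, hx, hmin, hc⟩
  have hlead : ∃ a ∈ V w N, ∃ u b, IsUnit u ∧ a = u * (y - c * x) ^ r + x * b := by
    have h1 : x ∣ y ^ r - (y - c * x) ^ r :=
      dvd_trans ⟨c, by ring⟩ (sub_dvd_pow_sub_pow y (y - c * x) r)
    obtain ⟨b, hb⟩ := h1
    exact ⟨f, hfV, u, g + u * b, hu, by rw [hg]; linear_combination u * hb⟩
  have D : Dat w x (y - c * x) e N N' r := ⟨hN', hle, hlead, hred⟩
  obtain ⟨R', _, _, _, w', t, Q⟩ := exists_QT C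
  haveI := isDomain_of_val w'
  haveI := Q.noeth
  haveI := Q.algc
  have hs' := tr7 C Q D hs hN'0
  have hord := tr6 C Q D hs hN'0
  have hred' := red' C Q D
  have hatt' := attained' C Q D hatt
  have hex : ∃ s, ¬ V w' N' ≤ maximalIdeal R' ^ (s + 1) := by
    obtain ⟨f', hf'⟩ := hatt'
    have hf0 : f' ≠ 0 := by
      rintro rfl
      rw [w'.v_zero] at hf'
      exact absurd hf'.symm (ENat.coe_ne_top _)
    obtain ⟨s, -, h2⟩ := ord_exists w' Q.pos hf0
    exact ⟨s, fun h => h2 (h (by rw [mem_V, hf']))⟩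
  classical
  obtain ⟨r', hr', hr'min⟩ : ∃ r', ¬ V w' N' ≤ maximalIdeal R' ^ (r' + 1) ∧
      V w' N' ≤ maximalIdeal R' ^ r' := by
    refine ⟨Nat.find hex, Nat.find_spec hex, ?_⟩
    rcases h : Nat.find hex with _ | k
    · simp
    · by_contra hk
      have := Nat.find_min' hex hk
      omega
  have hr'0 : r' ≠ 0 := by
    rintro rfl
    apply hr'
    rw [zero_add, pow_one]
    exact le_maximalIdeal (V_ne_top w' hN'0)
  obtain ⟨z, hzV, hz'⟩ := Set.not_subset.mp hr'
  obtain ⟨x', y', hM', hxm', u', hu', g', hg'⟩ :=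
    choose_par w' ⟨_, _, Q.hM'⟩ (hr'min hzV) hz'
  have hord' : OrdAt x' y' (V w' N') r' :=
    ⟨hr'min.trans (max_pow_le_ord hM' r'), z, hzV, u', g', hu', hg'⟩
  have hx'0 : x' ≠ 0 := (x_prime hM' Q.noprin).ne_zero
  obtain ⟨ω, hω⟩ := exists_nat w' hx'0
  have hlt : N' < N := by
    have := C.e_pos
    have : 0 < r * e := Nat.mul_pos (Nat.pos_of_ne_zero hr0) this
    omega
  obtain ⟨k, hk⟩ := IH N' hlt R' ⟨_, _, Q.hM'⟩ Q.noprin w' Q.pos hN'0 hatt' hs' hred' r' hr'min hr'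
    ω ⟨x', par_x hM', hω⟩ (fun m hm => hω ▸ hxm' m hm)
  have hrel := rel_eq w' Q.pos Q.hM' hM' Q.noprin hN'0 hred' (by rw [Q.val]; exact hx) hω hord hord'
  refine ⟨k, ?_⟩
  rw [hk] at hrel
  apply Nat.eq_of_mul_eq_mul_right (Nat.pos_of_ne_zero hr'0)
  rw [← hrel]; ring

end DegOne

namespace DegOne
universe u

lemma sup_red {R : Type u} [CommRing R] {K J A B : Ideal R} (hA : A ≤ J) (hB : B ≤ J)
    {n k : ℕ} (h1 : A ^ (n + 1) ≤ K * J ^ n) (h2 : B ^ (k + 1) ≤ K * J ^ k) :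
    (A ⊔ B) ^ (n + k + 1 + 1) ≤ K * J ^ (n + k + 1) := by
  change (A + B) ^ (n + k + 1 + 1) ≤ _
  rw [add_pow, Ideal.sum_eq_sup, Finset.sup_le_iff]
  intro i hi
  refine Ideal.mul_le_left.trans ?_
  rw [Finset.mem_range] at hi
  by_cases h : n + 1 ≤ i
  · obtain ⟨j, rfl⟩ := Nat.exists_eq_add_of_le h
    calc A ^ (n + 1 + j) * B ^ (n + k + 1 + 1 - (n + 1 + j))
        = A ^ (n + 1) * A ^ j * B ^ (n + k + 1 + 1 - (n + 1 + j)) := by rw [pow_add]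
      _ ≤ K * J ^ n * J ^ j * J ^ (n + k + 1 + 1 - (n + 1 + j)) :=
          Ideal.mul_mono (Ideal.mul_mono h1 (Ideal.pow_right_mono hA _)) (Ideal.pow_right_mono hB _)
      _ = K * J ^ (n + k + 1) := by
          rw [mul_assoc, mul_assoc, ← pow_add, ← pow_add]; congr 2; omega
  · obtain ⟨j, hj⟩ : ∃ j, n + k + 1 + 1 - i = k + 1 + j := ⟨n + k + 1 + 1 - i - (k + 1), by omega⟩
    rw [hj]
    calc A ^ i * B ^ (k + 1 + j) = B ^ (k + 1) * (B ^ j * A ^ i) := by rw [pow_add]; ring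
      _ ≤ K * J ^ k * (J ^ j * J ^ i) :=
          Ideal.mul_mono h2 (Ideal.mul_mono (Ideal.pow_right_mono hB _) (Ideal.pow_right_mono hA _))
      _ = K * J ^ (n + k + 1) := by
          rw [mul_assoc, ← pow_add, ← pow_add]; congr 2; omega

lemma red_of_integral {R : Type u} [CommRing R] {K J : Ideal R} (hJ : J.FG) (hK : K ≤ J)
    (h : ∀ f ∈ J, K.IsIntegralElemOver f) : ∃ k, J ^ (k + 1) ≤ K * J ^ k := by
  classical
  obtain ⟨S, hS⟩ := hJ
  have key : ∀ S : Finset R, (S : Set R) ⊆ J → ∃ k, Ideal.span (S : Set R) ^ (k + 1) ≤ K * J ^ k := by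
    intro S
    induction S using Finset.induction_on with
    | empty => intro _; exact ⟨0, by simp⟩
    | insert f S hf ih =>
      intro hS
      rw [Finset.coe_insert, Set.insert_subset_iff] at hS
      obtain ⟨k, hk⟩ := ih hS.2
      obtain ⟨n, hn, c, hc, hc'⟩ := h f hS.1
      obtain ⟨n, rfl⟩ : ∃ n', n = n' + 1 := ⟨n - 1, by omega⟩
      refine ⟨n + k + 1, ?_⟩
      rw [Finset.coe_insert, Ideal.span_insert]
      refine sup_red ((Ideal.span_singleton_le_iff_mem _).mpr hS.1) (Ideal.span_le.mpr hS.2) ?_ hk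
      rw [Ideal.span_singleton_pow, Ideal.span_singleton_le_iff_mem, eq_neg_of_add_eq_zero_left hc']
      apply neg_mem
      apply Ideal.sum_mem
      intro i hi
      have hci := hc i hi
      rw [Finset.mem_Icc] at hi
      obtain ⟨j, rfl⟩ : ∃ j, i = j + 1 := ⟨i - 1, by omega⟩
      rw [pow_succ'] at hci
      have : K * J ^ n = K * J ^ j * J ^ (n + 1 - (j + 1)) := by
        rw [mul_assoc, ← pow_add]; congr 2; omega
      rw [this]
      exact Ideal.mul_mem_mul (Ideal.mul_mono_right (Ideal.pow_right_mono hK _) hci)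
        (Ideal.pow_mem_pow hS.1 _)
  have := key S (by rw [← hS]; exact Ideal.subset_span)
  rwa [show Ideal.span (S : Set R) = J from hS] at this

lemma noPrin_of_dim {R : Type u} [CommRing R] [IsLocalRing R] [IsNoetherianRing R]
    (hdim : ringKrullDim R = 2) : NoPrin R := by
  intro z hz n hn
  have h1 : maximalIdeal R ∈ (Ideal.span {z}).minimalPrimes := by
    refine ⟨⟨inferInstance, (Ideal.span_singleton_le_iff_mem _).mpr hz⟩, ?_⟩
    rintro p ⟨hp, hzp⟩ _
    haveI := hp
    exact Ideal.IsPrime.le_of_pow_le (hn.trans hzp)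
  have h2 := Ideal.height_le_one_of_isPrincipal_of_mem_minimalPrimes (Ideal.span {z}) _ h1
  have h3 := IsLocalRing.maximalIdeal_height_eq_ringKrullDim (R := R)
  rw [hdim] at h3
  have h4 : (maximalIdeal R).height = 2 := by
    apply WithBot.coe_injective
    rw [h3]; rfl
  rw [h4] at h2
  exact absurd h2 (by decide)

lemma hs_quot {R : Type u} [CommRing R] [IsLocalRing R] [IsDomain R] [IsNoetherianRing R]
    {x y : R} (hM : maximalIdeal R = Ideal.span {x, y}) (hd : NoPrin R) {I : Ideal R} {r : ℕ}
    (h : OrdAt x y I r) (n : ℕ) :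
    hsLength (Ideal.map (Ideal.Quotient.mk (Ideal.span {x})) I) n = (n * r : ℕ) := by
  have hxp := x_prime hM hd
  haveI : (Ideal.span {x}).IsPrime := (Ideal.span_singleton_prime hxp.ne_zero).mpr hxp
  set φ := Ideal.Quotient.mk (Ideal.span {x}) with hφ
  have hφx : φ x = 0 := by
    rw [hφ, Ideal.Quotient.eq_zero_iff_mem]; exact Ideal.mem_span_singleton_self x
  have hy0 : φ y ≠ 0 := by
    rw [hφ, Ne, Ideal.Quotient.eq_zero_iff_mem, Ideal.mem_span_singleton]
    exact not_dvd_y hM hd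
  have hmap : Ideal.map φ I = Ideal.span {φ y ^ r} := by
    apply le_antisymm
    · rw [Ideal.map_le_iff_le_comap]
      intro z hz
      obtain ⟨c, b, hc⟩ := mem_sup_span.mp (h.1 hz)
      rw [Ideal.mem_comap, Ideal.mem_span_singleton, hc]
      exact ⟨φ c, by simp [hφx, mul_comm]⟩
    · rw [Ideal.span_singleton_le_iff_mem]
      obtain ⟨a, ha, u, b, hu, hab⟩ := h.2
      obtain ⟨v, hv⟩ := hu.exists_left_inv
      have h1 := Ideal.mul_mem_left _ (φ v) (Ideal.mem_map_of_mem φ ha)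
      have h2 : φ v * φ a = φ y ^ r := by
        have h3 : φ v * φ u = 1 := by rw [← map_mul, hv, map_one]
        rw [hab, map_add, map_mul, map_mul, hφx, map_pow]
        linear_combination φ y ^ r * h3
      rwa [h2] at h1
  have hmax : (Ideal.span {φ y}).IsMaximal := by
    have h1 : Ideal.span {φ y} = Ideal.map φ (maximalIdeal R) := by
      rw [hM, Ideal.map_span, Set.image_pair, hφx, Ideal.span_insert]; simp
    rw [h1]
    apply Ideal.IsMaximal.map_of_surjective_of_ker_le Ideal.Quotient.mk_surjective
    rw [Ideal.mk_ker, Ideal.span_singleton_le_iff_mem]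
    exact par_x hM
  unfold hsLength
  rw [moduleLength_eq, hmap, Ideal.span_singleton_pow, ← pow_mul, mul_comm r n]
  exact length_pi_pow hy0 hmax _

theorem final
    (R : Type u) [CommRing R] [IsLocalRing R] [IsNoetherianRing R]
    (hdim : ringKrullDim R = 2)
    (hreg : ∃ x y : R, maximalIdeal R = Ideal.span {x, y})
    [IsAlgClosed (ResidueField R)]
    (I : Ideal R) (hIc : I.IsComplete) (hIs : I.IsSimpleIdeal) (hIp : I.IsMPrimary)
    (w : DiscreteValuationOn R) (hw : IsReesValuationsOf I {w})
    (d : ℕ) (hd : IsDegreeCoeffOfUnique I w d) :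
    d = 1 := by
  classical
  haveI := isDomain_of_val w
  have hnp := noPrin_of_dim hdim
  have hI0 : ∃ f ∈ I, f ≠ 0 := by
    by_contra! hc
    have h1 : I = ⊥ := (Submodule.eq_bot_iff _).mpr hc
    have h2 : I.radical = maximalIdeal R := hIp
    apply hnp 0 (Ideal.zero_mem _) 1
    rw [pow_one, ← h2, h1]
    intro z hz
    obtain ⟨n, hn⟩ := hz
    have : z = 0 := eq_zero_of_pow_eq_zero ((Submodule.mem_bot R).mp hn)
    rw [this]; exact Ideal.zero_mem _
  have hexN : ∃ N : ℕ, ∃ f ∈ I, w.v f = N := by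
    obtain ⟨f, hf, hf0⟩ := hI0
    obtain ⟨n, hn⟩ := exists_nat w hf0
    exact ⟨n, f, hf, hn⟩
  obtain ⟨N, ⟨f₁, hf₁, hwf₁⟩, hNmin⟩ : ∃ N : ℕ, (∃ f ∈ I, w.v f = N) ∧
      ∀ f ∈ I, (N : ℕ∞) ≤ w.v f := by
    refine ⟨Nat.find hexN, Nat.find_spec hexN, fun f hf => ?_⟩
    by_cases hf0 : f = 0
    · rw [hf0, w.v_zero]; exact le_top
    obtain ⟨n, hn⟩ := exists_nat w hf0
    rw [hn]
    exact_mod_cast Nat.find_min' hexN ⟨f, hf, hn⟩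
  have hval : valIdeal w I = N := by
    unfold valIdeal
    apply le_antisymm
    · rw [← hwf₁]; exact iInf₂_le f₁ hf₁
    · exact le_iInf₂ hNmin
  have hintg : ∀ (m : ℕ) (z : R), (I ^ m).IsIntegralElemOver z ↔ z ∈ V w (m * N) := by
    intro m z
    rw [hw.2.1 m z, mem_V]
    simp [hval]
  have hIV : I = V w N := by
    apply le_antisymm
    · exact fun f hf => hNmin f hf
    · intro f hf
      apply hIc
      have := (hintg 1 f).mpr (by rwa [one_mul])
      rwa [pow_one] at this
  have hN : 0 < N := by
    by_contra h
    have h0 : N = 0 := by omega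
    apply hIs.1
    rw [hIV, h0, V_zero]
  have hpos : ∀ z ∈ maximalIdeal R, w.v z ≠ 0 := by
    intro z hz hz0
    rw [← show I.radical = maximalIdeal R from hIp] at hz
    obtain ⟨n, hn⟩ := hz
    have h1 := hNmin _ hn
    rw [v_pow, hz0, mul_zero] at h1
    have : N ≤ 0 := by exact_mod_cast h1
    omega
  have hred : Red w N := by
    intro m
    rw [← hIV]
    apply red_of_integral (IsNoetherian.noetherian _)
    · rw [hIV]; exact pow_le_V w le_rfl m
    · exact fun f hf => (hintg m f).mpr hf
  have hex : ∃ s, ¬ V w N ≤ maximalIdeal R ^ (s + 1) := by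
    obtain ⟨f, hf, hf0⟩ := hI0
    obtain ⟨s, -, h2⟩ := ord_exists w hpos hf0
    exact ⟨s, fun h => h2 (h (hIV ▸ hf))⟩
  obtain ⟨r, hr, hrle⟩ : ∃ r', ¬ V w N ≤ maximalIdeal R ^ (r' + 1) ∧
      V w N ≤ maximalIdeal R ^ r' := by
    refine ⟨Nat.find hex, Nat.find_spec hex, ?_⟩
    rcases h : Nat.find hex with _ | k
    · simp
    · by_contra hk
      have := Nat.find_min' hex hk
      omega
  have hr0 : r ≠ 0 := by
    rintro rfl
    apply hr
    rw [zero_add, pow_one]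
    exact le_maximalIdeal (V_ne_top w hN)
  obtain ⟨z, hzV, hz'⟩ := Set.not_subset.mp hr
  obtain ⟨x, y, hM, hxm, u, hu, g, hg⟩ := choose_par w hreg (hrle hzV) hz'
  have hord : OrdAt x y I r := by
    rw [hIV]
    exact ⟨hrle.trans (max_pow_le_ord hM r), z, hzV, u, g, hu, hg⟩
  have hx0 : x ≠ 0 := (x_prime hM hnp).ne_zero
  obtain ⟨e, he⟩ := exists_nat w hx0
  obtain ⟨c, hc⟩ := main_induction N R hreg hnp w hpos hN ⟨f₁, hwf₁⟩ (hIV ▸ hIs) hred r hrle hr e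
    ⟨x, par_x hM, he⟩ (fun m hm => he ▸ hxm m hm)
  obtain ⟨a, b, hab⟩ := hd x (par_x hM) hx0
  rw [Filter.eventually_atTop] at hab
  obtain ⟨n, hn⟩ := hab
  have key : ∀ k ≥ n, k * r + a = d * e * k + b := by
    intro k hk
    have := hn k hk
    rw [hs_quot hM hnp hord, he] at this
    exact_mod_cast this
  have k1 := key n le_rfl
  have k2 := key (n + 1) (Nat.le_succ n)
  have k3 : r = d * e := by nlinarith
  have k4 : d * c = 1 := by
    apply Nat.eq_of_mul_eq_mul_right (Nat.pos_of_ne_zero hr0)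
    rw [one_mul, mul_assoc, ← hc]; exact k3.symm
  exact Nat.eq_one_of_mul_eq_one_right k4

end DegOne

theorem degree_coeff_of_simple_complete_eq_one
    (R : Type*) [CommRing R] [IsLocalRing R] [IsNoetherianRing R]
    (hdim : ringKrullDim R = 2)
    (hreg : ∃ x y : R, maximalIdeal R = Ideal.span {x, y})
    [IsAlgClosed (ResidueField R)]
    (I : Ideal R) (hIc : I.IsComplete) (hIs : I.IsSimpleIdeal) (hIp : I.IsMPrimary)
    (w : DiscreteValuationOn R) (hw : IsReesValuationsOf I {w})
    (d : ℕ) (hd : IsDegreeCoeffOfUnique I w d) :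
    d = 1 := by
  exact DegOne.final R hdim hreg I hIc hIs hIp w hw d hd
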